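/- arXiv:0909.4563 — 6 statements merged into one kernel-verified Lean document; each statement's English description precedes it below -/
import Mathlib

section
/- Let X be a separable metrizable topological space. Then either X is locally compact and finite dimensional, in which case basic(X) is finite, or X is not locally compact or is infinite dimensional, in which case basic(X) = 𝔠 = 2^ℵ0. -/
open Cardinal Set Topology

noncomputable section

/-- A family `Φ ⊆ C(X)` is basic if every continuous real-valued function on `X`
is a finite sum of compositions `gᵢ ∘ φᵢ` with `φᵢ ∈ Φ` and `gᵢ ∈ C(ℝ)`. -/
def IsBasicFamily {X : Type u} [TopologicalSpace X] (Φ : Set C(X, ℝ)) : Prop :=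
  ∀ f : C(X, ℝ), ∃ (m : ℕ) (φ : Fin m → C(X, ℝ)) (g : Fin m → C(ℝ, ℝ)),
    (∀ i, φ i ∈ Φ) ∧ ∀ x, f x = ∑ i, g i (φ i x)

/-- `basic(X)`: the least cardinality of a basic family for `X`. -/
def basicCard (X : Type u) [TopologicalSpace X] : Cardinal.{u} :=
  sInf { c | ∃ Φ : Set C(X, ℝ), IsBasicFamily Φ ∧ #Φ = c }

/-- `dim X ≤ n`: every continuous map of a closed subspace of `X` into the
`n`-sphere extends continuously over `X`. -/
def DimLE (X : Type u) [TopologicalSpace X] (n : ℕ) : Prop :=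
  ∀ A : Set X, IsClosed A →
    ∀ f : C(A, Metric.sphere (0 : EuclideanSpace ℝ (Fin (n + 1))) 1),
      ∃ F : C(X, Metric.sphere (0 : EuclideanSpace ℝ (Fin (n + 1))) 1),
        ∀ a : A, F a = f a

/-- A Cantor set in `Y` is a subspace homeomorphic to the Cantor space `{0,1}^ℕ`. -/
def IsCantorSet {Y : Type u} [TopologicalSpace Y] (C : Set Y) : Prop :=
  Nonempty (C ≃ₜ (ℕ → Bool))

/-- Strong independence of a family `𝒞 ⊆ C(X)`. -/
def StronglyIndep {X : Type u} [TopologicalSpace X] (𝒞 : Set C(X, ℝ)) : Prop :=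
  ∀ (n : ℕ) (φ : C(X, Fin n → ℝ)),
    #(𝒞 ∩ { f : C(X, ℝ) | ∃ g : C((Fin n → ℝ), ℝ), ∀ x, f x = g (φ x) } : Set C(X, ℝ)) ≤ n

/-- Weak independence of a family `𝒞 ⊆ C(X)`. -/
def WeaklyIndep {X : Type u} [TopologicalSpace X] (𝒞 : Set C(X, ℝ)) : Prop :=
  ∀ (n : ℕ) (φ : Fin n → C(X, ℝ)),
    #(𝒞 ∩ { f : C(X, ℝ) | ∃ g : Fin n → C(ℝ, ℝ), ∀ x, f x = ∑ i, g i (φ i x) } : Set C(X, ℝ)) < 𝔠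

/-- The weight of a topological space: least cardinality of a basis. -/
def weightCard (X : Type u) [TopologicalSpace X] : Cardinal.{u} :=
  sInf { c | ∃ B : Set (Set X), TopologicalSpace.IsTopologicalBasis B ∧ #B = c }

/-- `cof([κ]^{ℵ₀}, ⊆)`: least cardinality of a family of countably infinite subsets
of (a set of size) `κ` which is cofinal in the countably infinite subsets. -/
def cofCtblSubsets (κ : Cardinal.{u}) : Cardinal.{u} :=
  sInf { c | ∃ 𝒞 : Set (Set κ.out),
    (∀ C ∈ 𝒞, C.Countable ∧ C.Infinite) ∧
    (∀ S : Set κ.out, S.Countable → S.Infinite → ∃ C ∈ 𝒞, S ⊆ C) ∧ #𝒞 = c }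

theorem mk_continuousMap_le_continuum (X : Type u) [TopologicalSpace X]
    [TopologicalSpace.SeparableSpace X] : #C(X, ℝ) ≤ 𝔠 := by
  obtain ⟨D, hDc, hD⟩ := TopologicalSpace.exists_countable_dense X
  have hinj : Function.Injective (fun (f : C(X, ℝ)) (d : D) => f d) := by
    intro f g hfg
    refine ContinuousMap.coe_injective (f.continuous.ext_on hD g.continuous ?_)
    intro x hx
    exact congrFun hfg ⟨x, hx⟩
  refine (Cardinal.mk_le_of_injective hinj).trans ?_
  have h := hDc.le_aleph0
  simp only [mk_pi, mk_real, prod_const, lift_continuum, lift_uzero]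
  calc (𝔠 : Cardinal.{u}) ^ #D ≤ 𝔠 ^ ℵ₀ := by
        simpa using Cardinal.power_le_power_left continuum_ne_zero h
    _ = 𝔠 := continuum_power_aleph0

/-- If a `𝔠`-indexed family of functions is such that every map into a Euclidean space
induces only countably many of its members, then no basic family has fewer than `𝔠` elements. -/
theorem continuum_le_mk_of_isBasicFamily {X : Type u} [TopologicalSpace X]
    (F : (ℕ → Bool) → C(X, ℝ))
    (hF : ∀ (m : ℕ) (φ : C(X, Fin m → ℝ)),
      {α | ∃ g : C(Fin m → ℝ, ℝ), ∀ x, F α x = g (φ x)}.Countable)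
    (Φ : Set C(X, ℝ)) (hΦ : IsBasicFamily Φ) : 𝔠 ≤ #Φ := by
  by_contra! hlt
  choose m φ g hmem hrep using fun α => hΦ (F α)
  let code : (ℕ → Bool) → List Φ := fun α => List.ofFn fun i => ⟨φ α i, hmem α i⟩
  have hfib : ∀ l : List Φ, (code ⁻¹' {l}).Countable := by
    intro l
    let ψ : C(X, Fin l.length → ℝ) := ⟨fun x i => (l.get i : C(X, ℝ)) x, by fun_prop⟩
    refine (hF l.length ψ).mono ?_
    rintro α rfl
    have hlen : (code α).length = m α := by simp [code]
    refine ⟨⟨fun y => ∑ i, g α (Fin.cast hlen i) (y i), by fun_prop⟩, fun x => ?_⟩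
    rw [hrep α x]
    refine (Fintype.sum_equiv (finCongr hlen) _ _ ?_).symm
    intro i
    simp [ψ, code]
    rfl
  have hcard : lift.{u} #(ℕ → Bool) ≤ #(List Φ) * ℵ₀ := by
    have h1 : lift.{u} #(ℕ → Bool) = lift.{0} #(Σ l : List Φ, code ⁻¹' {l}) :=
      Cardinal.mk_congr_lift (Equiv.sigmaFiberEquiv code).symm
    rw [h1, lift_uzero, mk_sigma]
    refine (Cardinal.sum_le_sum _ (fun _ => ℵ₀) fun l => ?_).trans ?_
    · exact (hfib l).le_aleph0
    · simp
  have hlist : #(List Φ) < 𝔠 := (Cardinal.mk_list_le_max _).trans_lt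
    (max_lt aleph0_lt_continuum hlt)
  have : (𝔠 : Cardinal.{u}) ≤ #(List Φ) * ℵ₀ := by
    simpa using hcard
  exact absurd this (not_le.2 (mul_lt_of_lt aleph0_lt_continuum.le hlist aleph0_lt_continuum))

theorem exists_isClosedEmbedding_nat_of_not_isCompact {X : Type u} [MetricSpace X] {K : Set X}
    (hK : IsClosed K) (hc : ¬ IsCompact K) :
    ∃ d : ℕ → X, IsClosedEmbedding d ∧ ∀ k, d k ∈ K := by
  rw [isCompact_iff_isSeqCompact] at hc
  simp only [IsSeqCompact, not_forall, not_exists, not_and, exists_prop] at hc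
  obtain ⟨x, hxK, hx⟩ := hc
  have hlf : LocallyFinite fun n => ({x n} : Set X) := by
    intro a
    by_contra! hcon
    have hcl : MapClusterPt a Filter.atTop x := by
      rw [mapClusterPt_iff_frequently]
      intro U hU
      rw [Nat.frequently_atTop_iff_infinite]
      refine (hcon U hU).mono ?_
      rintro n ⟨y, hy, hyU⟩
      obtain rfl : y = x n := hy
      exact hyU
    have haK : a ∈ K := by
      refine hK.closure_subset (mem_closure_iff_nhds.2 fun U hU => ?_)
      obtain ⟨n, hn⟩ := (mapClusterPt_iff_frequently.1 hcl U hU).exists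
      exact ⟨x n, hn, hxK n⟩
    obtain ⟨ψ, hψ, hψ'⟩ := hcl.tendsto_subseq
    exact hx a haK ψ hψ hψ'
  have hinf : (range x).Infinite := by
    intro hfin
    have := hlf.finite_nonempty_inter_compact hfin.isCompact
    refine Set.infinite_univ (this.subset ?_)
    intro n _
    exact ⟨x n, rfl, n, rfl⟩
  have e := hinf.natEmbedding
  choose i hi using fun k => (e k).2
  have hiinj : Function.Injective i := by
    intro k l hkl
    apply e.injective
    apply Subtype.ext
    rw [← hi k, ← hi l, hkl]
  refine ⟨x ∘ i, IsClosedEmbedding.of_continuous_injective_isClosedMap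
    continuous_of_discreteTopology ?_ ?_, fun k => hxK _⟩
  · intro k l hkl
    apply e.injective
    apply Subtype.ext
    rw [← hi k, ← hi l]
    exact hkl
  · intro s _
    have : (x ∘ i) '' s = ⋃ k : s, {x (i k)} := by
      ext y
      simp [eq_comm]
    rw [this]
    refine LocallyFinite.isClosed_iUnion
      (hlf.comp_injective (hiinj.comp Subtype.val_injective)) fun k => isClosed_singleton

theorem exists_annulus_isClosedEmbedding_nat {X : Type u} [MetricSpace X] (x₀ : X) (r : ℝ)
    (hc : ¬ IsCompact (Metric.closedBall x₀ r)) :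
    ∃ ρ > 0, ρ ≤ r ∧ ∃ d : ℕ → X, IsClosedEmbedding d ∧
      ∀ k, ρ ≤ dist (d k) x₀ ∧ dist (d k) x₀ ≤ r := by
  obtain ⟨d, hd, hdK⟩ := exists_isClosedEmbedding_nat_of_not_isCompact Metric.isClosed_closedBall hc
  have hev : ∃ ρ > 0, ∃ N, ∀ k, ρ ≤ dist (d (k + N)) x₀ := by
    have hcl : IsClosed (d '' {k | d k ≠ x₀}) := hd.isClosedMap _ (isClosed_discrete _)
    have hn : (d '' {k | d k ≠ x₀})ᶜ ∈ 𝓝 x₀ := by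
      refine hcl.isOpen_compl.mem_nhds ?_
      rintro ⟨k, hk, hk'⟩
      exact hk hk'
    obtain ⟨ρ, hρ, hball⟩ := Metric.mem_nhds_iff.1 hn
    have hN : ∃ N, ∀ k, d (k + N) ≠ x₀ := by
      by_cases h : ∃ k, d k = x₀
      · obtain ⟨k, hk⟩ := h
        refine ⟨k + 1, fun l hl => ?_⟩
        have := hd.injective (hl.trans hk.symm)
        omega
      · push Not at h
        exact ⟨0, fun k => h _⟩
    obtain ⟨N, hN⟩ := hN
    refine ⟨ρ, hρ, N, fun k => ?_⟩
    by_contra! hlt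
    exact hball (Metric.mem_ball.2 hlt) ⟨k + N, hN k, rfl⟩
  obtain ⟨ρ, hρ, N, hN⟩ := hev
  refine ⟨ρ, hρ, (hN 0).trans (hdK _), fun k => d (k + N), ?_, fun k => ⟨hN k, hdK _⟩⟩
  refine hd.comp (IsClosedEmbedding.of_continuous_injective_isClosedMap
    continuous_of_discreteTopology (add_left_injective N) fun s _ => isClosed_discrete _)

theorem countable_of_forall_ne_le_dist {I Y : Type*} [MetricSpace Y]
    [TopologicalSpace.SeparableSpace Y] (G : I → Y) {δ : ℝ} (hδ : 0 < δ)
    (hG : ∀ i j, i ≠ j → δ ≤ dist (G i) (G j)) : Countable I := by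
  obtain ⟨D, hDc, hD⟩ := TopologicalSpace.exists_countable_dense Y
  choose d hdD hd using fun i => hD.exists_dist_lt (G i) (half_pos hδ)
  have : Countable D := hDc.to_subtype
  refine Function.Injective.countable (f := fun i => (⟨d i, hdD i⟩ : D)) ?_
  intro i j hij
  by_contra hne
  have h1 := hG i j hne
  have hdd : d i = d j := congrArg Subtype.val hij
  have h2 := dist_triangle_right (G i) (G j) (d i)
  have h3 := hd i
  have h4 := hd j
  rw [← hdd] at h4
  linarith

theorem continuous_tsum_half_pow_mul {X : Type*} [TopologicalSpace X] (v : ℕ → C(X, ℝ))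
    (hv : ∀ n x, |v n x| ≤ 1) : Continuous fun x => ∑' n, (1 / 2 : ℝ) ^ n * v n x := by
  refine continuous_tsum (fun n => by fun_prop) summable_geometric_two fun n x => ?_
  rw [Real.norm_eq_abs, abs_mul, abs_of_nonneg (by positivity)]
  exact mul_le_of_le_one_right (by positivity) (hv n x)

theorem exists_cantor_family_of_not_locallyCompactSpace (X : Type u) [TopologicalSpace X]
    [TopologicalSpace.MetrizableSpace X] (hX : ¬ LocallyCompactSpace X) :
    ∃ F : (ℕ → Bool) → C(X, ℝ), ∀ (m : ℕ) (φ : C(X, Fin m → ℝ)),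
      {α | ∃ g : C(Fin m → ℝ, ℝ), ∀ x, F α x = g (φ x)}.Countable := by
  let _ := TopologicalSpace.metrizableSpaceMetric X
  have hx : ∃ x₀ : X, ∀ r > 0, ¬ IsCompact (Metric.closedBall x₀ r) := by
    by_contra! hcon
    have : WeaklyLocallyCompactSpace X := ⟨fun x => by
      obtain ⟨r, hr, hc⟩ := hcon x
      exact ⟨_, hc, Metric.closedBall_mem_nhds x hr⟩⟩
    exact hX inferInstance
  obtain ⟨x₀, hx₀⟩ := hx
  have : Nonempty X := ⟨x₀⟩
  choose! ρ hρ hρr D hD hDρ using fun (r : ℝ) (hr : r > 0) =>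
    exists_annulus_isClosedEmbedding_nat x₀ r (hx₀ r hr)
  let r : ℕ → ℝ := fun n => Nat.rec 1 (fun _ s => ρ s / 4) n
  have hr0 : r 0 = 1 := rfl
  have hrs : ∀ n, r (n + 1) = ρ (r n) / 4 := fun n => rfl
  have hrpos : ∀ n, 0 < r n := by
    intro n
    induction n with
    | zero => rw [hr0]; exact one_pos
    | succ n ih => rw [hrs]; exact div_pos (hρ _ ih) (by norm_num)
  have hanti : Antitone r := by
    refine antitone_nat_of_succ_le fun n => ?_
    rw [hrs]
    have := hρr _ (hrpos n)
    have := hρ _ (hrpos n)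
    linarith
  have hrlim : ∀ n, r n ≤ (1 / 4) ^ n := by
    intro n
    induction n with
    | zero => simp [hr0]
    | succ n ih =>
      rw [hrs, pow_succ]
      have := hρr _ (hrpos n)
      linarith
  have hw : ∀ n, ∃ w : C(X, ℝ), (∀ x, dist x x₀ ≤ ρ (r n) / 2 ∨ 2 * r n ≤ dist x x₀ → w x = 0) ∧
      (∀ x, ρ (r n) ≤ dist x x₀ ∧ dist x x₀ ≤ r n → w x = 1) ∧ ∀ x, w x ∈ Icc (0 : ℝ) 1 := by
    intro n
    have hp := hrpos n
    have hq := hρ _ hp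
    obtain ⟨w, h0, h1, h2⟩ := exists_continuous_zero_one_of_isClosed
      (s := {x | dist x x₀ ≤ ρ (r n) / 2} ∪ {x | 2 * r n ≤ dist x x₀})
      (t := {x | ρ (r n) ≤ dist x x₀} ∩ {x | dist x x₀ ≤ r n})
      ((isClosed_le (by fun_prop) (by fun_prop)).union (isClosed_le (by fun_prop) (by fun_prop)))
      ((isClosed_le (by fun_prop) (by fun_prop)).inter (isClosed_le (by fun_prop) (by fun_prop)))
      (by
        rw [Set.disjoint_left]
        rintro x (hx | hx) ⟨hy, hz⟩ <;> simp only [mem_ofPred_eq] at hx hy hz <;> linarith)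
    exact ⟨w, fun x hx => h0 hx, fun x hx => h1 hx, h2⟩
  choose w hw0 hw1 hw2 using hw
  have hu : ∀ (n : ℕ) (α : ℕ → Bool), ∃ u : C(X, Icc (0 : ℝ) 1),
      ∀ k, (u (D (r n) k) : ℝ) = if α k then 1 else 0 := by
    intro n α
    obtain ⟨u, hu⟩ := ContinuousMap.exists_extension (hD _ (hrpos n))
      (⟨fun k => if α k then 1 else 0, continuous_of_discreteTopology⟩ : C(ℕ, Icc (0 : ℝ) 1))
    refine ⟨u, fun k => ?_⟩
    have := congrArg (Subtype.val) (DFunLike.congr_fun hu k)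
    rw [ContinuousMap.comp_apply] at this
    refine Eq.trans this ?_
    by_cases h : α k <;> simp [h]
  choose u hu using hu
  let v : (ℕ → Bool) → ℕ → C(X, ℝ) := fun α n => ⟨fun x => w n x * u n α x, by fun_prop⟩
  have hv : ∀ α n x, |v α n x| ≤ 1 := by
    intro α n x
    have h1 := hw2 n x
    have h2 := (u n α x).2
    change |w n x * (u n α x : ℝ)| ≤ 1
    rw [abs_of_nonneg (mul_nonneg h1.1 h2.1)]
    exact mul_le_one₀ h1.2 h2.1 h2.2
  let F : (ℕ → Bool) → C(X, ℝ) := fun α => ⟨_, continuous_tsum_half_pow_mul (v α) (hv α)⟩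
  have hF : ∀ α n k, F α (D (r n) k) = (1 / 2) ^ n * if α k then 1 else 0 := by
    intro α n k
    have hk := hDρ _ (hrpos n) k
    have : F α (D (r n) k) = (1 / 2) ^ n * v α n (D (r n) k) := by
      refine tsum_eq_single n fun m hm => ?_
      have : w m (D (r n) k) = 0 := by
        apply hw0
        rcases lt_or_gt_of_ne hm with h | h
        · left
          have h3 := hanti (Nat.succ_le_of_lt h)
          rw [Nat.succ_eq_add_one, hrs] at h3
          have := hρ _ (hrpos m)
          linarith
        · right
          have h3 := hanti (Nat.succ_le_of_lt h)
          rw [Nat.succ_eq_add_one, hrs] at h3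
          have := hρ _ (hrpos n)
          linarith
      simp [v, this]
    rw [this]
    simp only [v, ContinuousMap.coe_mk, hu, hw1 n _ hk, one_mul]
  refine ⟨F, fun m φ => ?_⟩
  have hφ : ∃ n, ∀ k, φ (D (r n) k) ∈ Metric.closedBall (φ x₀) 1 := by
    obtain ⟨δ, hδ, hball⟩ := Metric.mem_nhds_iff.1
      (φ.continuous.continuousAt (Metric.closedBall_mem_nhds (φ x₀) one_pos))
    obtain ⟨n, hn⟩ := exists_pow_lt_of_lt_one hδ (show (1 / 4 : ℝ) < 1 by norm_num)
    exact ⟨n, fun k => hball (Metric.mem_ball.2 (((hDρ _ (hrpos n) k).2.trans (hrlim n)).trans_lt hn))⟩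
  obtain ⟨n, hn⟩ := hφ
  have hKc : CompactSpace (Metric.closedBall (φ x₀) 1) :=
    isCompact_iff_compactSpace.1 (isCompact_closedBall _ _)
  choose g hg using fun α : {α | ∃ g : C(Fin m → ℝ, ℝ), ∀ x, F α x = g (φ x)} => α.2
  refine countable_of_forall_ne_le_dist
    (fun α => (g α).restrict (Metric.closedBall (φ x₀) 1)) (δ := (1 / 2) ^ n) (by positivity) ?_
  intro α β hne
  have hk : ∃ k, α.1 k ≠ β.1 k := by
    by_contra! h
    exact hne (Subtype.ext (funext h))
  obtain ⟨k, hk⟩ := hk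
  refine le_trans ?_ (ContinuousMap.dist_apply_le_dist ⟨φ (D (r n) k), hn k⟩)
  rw [ContinuousMap.restrict_apply, ContinuousMap.restrict_apply, ← hg α, ← hg β, hF, hF,
    Real.dist_eq, ← mul_sub, abs_mul, abs_of_nonneg (by positivity : (0 : ℝ) ≤ (1 / 2) ^ n)]
  cases h1 : α.1 k <;> cases h2 : β.1 k <;> simp_all

theorem exists_approx_forall_mem_of_isCompact {X : Type*} [TopologicalSpace X] {J : Type*}
    [Countable J] {K : J → Set X} {ι : Type} [Fintype ι] (hK : ∀ j, IsCompact (K j))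
    {W : J → Set (ι → ℝ)} (hW : ∀ j, IsOpen (W j))
    (h : ∀ j (f : C(X, ι → ℝ)) (ε : ℝ), 0 < ε →
      ∃ g : C(X, ι → ℝ), (∀ x i, |g x i - f x i| ≤ ε) ∧ ∀ x ∈ K j, g x ∈ W j)
    (f : C(X, ι → ℝ)) {ε : ℝ} (hε : 0 < ε) :
    ∃ g : C(X, ι → ℝ), (∀ x i, |g x i - f x i| ≤ ε) ∧ ∀ j, ∀ x ∈ K j, g x ∈ W j := by
  let U : J → Set (BoundedContinuousFunction X (ι → ℝ)) := fun j =>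
    {d | ∀ x ∈ K j, f x + d x ∈ W j}
  have hUo : ∀ j, IsOpen (U j) := by
    intro j
    rw [Metric.isOpen_iff]
    intro d hd
    obtain ⟨δ, hδ, hδW⟩ := ((hK j).image (f := fun x => f x + d x)
      (by fun_prop)).exists_thickening_subset_open (hW j) (image_subset_iff.2 hd)
    refine ⟨δ, hδ, fun d' hd' x hx => hδW ?_⟩
    refine Metric.mem_thickening_iff.2 ⟨_, mem_image_of_mem _ hx, ?_⟩
    rw [dist_add_left]
    exact (BoundedContinuousFunction.dist_coe_le_dist x).trans_lt hd'
  have hUd : ∀ j, Dense (U j) := by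
    intro j
    rw [Metric.dense_iff]
    intro d r hr
    obtain ⟨g, hg, hg'⟩ := h j (f + d.toContinuousMap) (r / 2) (half_pos hr)
    let e : BoundedContinuousFunction X (ι → ℝ) :=
      BoundedContinuousFunction.ofNormedAddCommGroup (fun x => g x - (f x + d x)) (by fun_prop)
        (r / 2) (fun x => (pi_norm_le_iff_of_nonneg (half_pos hr).le).2 fun i => hg x i)
    refine ⟨d + e, ?_, ?_⟩
    · rw [Metric.mem_ball, dist_eq_norm, add_sub_cancel_left]
      exact (BoundedContinuousFunction.norm_ofNormedAddCommGroup_le _ (half_pos hr).le _).trans_lt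
        (half_lt_self hr)
    · intro x hx
      have : f x + (d + e) x = g x := by
        simp only [e, BoundedContinuousFunction.coe_add, Pi.add_apply,
          BoundedContinuousFunction.coe_ofNormedAddCommGroup]
        abel
      rw [this]
      exact hg' x hx
  obtain ⟨d, hd, hdU⟩ := Metric.dense_iff.1 (dense_iInter_of_isOpen hUo hUd) 0 ε hε
  refine ⟨f + d.toContinuousMap, fun x i => ?_, fun j x hx => mem_iInter.1 hdU j x hx⟩
  have h1 : ‖d x‖ ≤ ‖d‖ := d.norm_coe_le_norm x
  have h2 := norm_le_pi_norm (d x) i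
  rw [mem_ball_zero_iff] at hd
  simpa using h2.trans (h1.trans hd.le)

/-- Every map to `ι → ℝ` has arbitrarily good uniform approximations without zeros on `S`. -/
def Avoids {X : Type*} [TopologicalSpace X] (S : Set X) (ι : Type) : Prop :=
  ∀ (f : C(X, ι → ℝ)) (ε : ℝ), 0 < ε →
    ∃ g : C(X, ι → ℝ), (∀ x i, |g x i - f x i| ≤ ε) ∧ ∀ x ∈ S, g x ≠ 0

namespace Avoids

variable {X : Type*} [TopologicalSpace X]

theorem mono {S T : Set X} {ι : Type} (h : Avoids T ι) (hST : S ⊆ T) : Avoids S ι := by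
  intro f ε hε
  obtain ⟨g, hg, hg'⟩ := h f ε hε
  exact ⟨g, hg, fun x hx => hg' x (hST hx)⟩

theorem of_injective {S : Set X} {ι κ : Type} (h : Avoids S ι) (e : ι → κ)
    (he : Function.Injective e) : Avoids S κ := by
  classical
  intro f ε hε
  obtain ⟨g, hg, hg'⟩ := h ⟨fun x i => f x (e i), by fun_prop⟩ ε hε
  refine ⟨⟨fun x => Function.extend e (g x) (f x), ?_⟩, ?_, ?_⟩
  · refine continuous_pi fun k => ?_
    by_cases hk : ∃ i, e i = k
    · obtain ⟨i, rfl⟩ := hk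
      simp only [he.extend_apply]
      fun_prop
    · simp only [Function.extend_apply' _ _ _ hk]
      fun_prop
  · intro x k
    by_cases hk : ∃ i, e i = k
    · obtain ⟨i, rfl⟩ := hk
      simpa [he.extend_apply] using hg x i
    · simp [Function.extend_apply' _ _ _ hk, hε.le]
  · intro x hx h0
    refine hg' x hx (funext fun i => ?_)
    have := congrFun h0 (e i)
    simpa [he.extend_apply] using this

theorem mono_card {S : Set X} {m n : ℕ} (h : Avoids S (Fin m)) (hmn : m ≤ n) :
    Avoids S (Fin n) :=
  h.of_injective (Fin.castLE hmn) (Fin.castLE_injective hmn)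

theorem singleton (x : X) (ι : Type) [Nonempty ι] : Avoids {x} ι := by
  intro f ε hε
  obtain ⟨i⟩ := ‹Nonempty ι›
  by_cases h : f x = 0
  · refine ⟨f + ContinuousMap.const X fun _ => ε, fun y j => by simp [abs_of_pos hε], ?_⟩
    rintro y rfl h0
    have := congrFun h0 i
    simp [h] at this
    exact hε.ne' this
  · exact ⟨f, fun y j => by simp [hε.le], by rintro y rfl; exact h⟩

theorem iUnion_of_isCompact {J : Type*} [Countable J] {K : J → Set X} {ι : Type} [Fintype ι]
    (hK : ∀ j, IsCompact (K j)) (h : ∀ j, Avoids (K j) ι) : Avoids (⋃ j, K j) ι := by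
  intro f ε hε
  obtain ⟨g, hg, hg'⟩ := exists_approx_forall_mem_of_isCompact hK
    (W := fun _ => {0}ᶜ) (fun _ => isOpen_compl_singleton) h f hε
  refine ⟨g, hg, fun x hx => ?_⟩
  obtain ⟨j, hj⟩ := mem_iUnion.1 hx
  exact hg' j x hj

theorem iUnion_of_isClosed [SigmaCompactSpace X] {J : Type*} [Countable J] {F : J → Set X}
    {ι : Type} [Fintype ι] (hF : ∀ j, IsClosed (F j)) (h : ∀ j, Avoids (F j) ι) :
    Avoids (⋃ j, F j) ι := by
  refine (iUnion_of_isCompact (K := fun p : J × ℕ => F p.1 ∩ compactCovering X p.2)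
    (fun p => (isCompact_compactCovering X p.2).inter_left (hF p.1))
    (fun p => (h p.1).mono inter_subset_left)).mono ?_
  intro x hx
  obtain ⟨j, hj⟩ := mem_iUnion.1 hx
  obtain ⟨n, hn⟩ := mem_iUnion.1 ((iUnion_compactCovering X).symm ▸ mem_univ x)
  exact mem_iUnion.2 ⟨(j, n), hj, hn⟩

theorem union_of_isClosed [SigmaCompactSpace X] {S T : Set X} {ι : Type} [Fintype ι]
    (hS : IsClosed S) (hT : IsClosed T) (h : Avoids S ι) (h' : Avoids T ι) :
    Avoids (S ∪ T) ι := by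
  rw [union_eq_iUnion]
  exact iUnion_of_isClosed (Bool.forall_bool.2 ⟨hT, hS⟩) (Bool.forall_bool.2 ⟨h', h⟩)

end Avoids

theorem DimLE.avoids_univ {X : Type u} [TopologicalSpace X] {n : ℕ} (h : DimLE X n) :
    Avoids (univ : Set X) (Fin (n + 1)) := by
  intro f ε hε
  let f' : C(X, EuclideanSpace ℝ (Fin (n + 1))) := ⟨fun x => WithLp.toLp 2 (f x), by fun_prop⟩
  let A : Set X := {x | ε / 2 ≤ ‖f' x‖}
  have hA : IsClosed A := isClosed_le (by fun_prop) (by fun_prop)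
  have hpos : ∀ a : A, 0 < ‖f' a‖ := fun a => (half_pos hε).trans_le a.2
  have hmem : ∀ a : A, ‖f' a‖⁻¹ • f' a ∈
      Metric.sphere (0 : EuclideanSpace ℝ (Fin (n + 1))) 1 := fun a => by
    rw [mem_sphere_zero_iff_norm, norm_smul, norm_inv, norm_norm, inv_mul_cancel₀ (hpos a).ne']
  have hcont : Continuous fun a : A => ‖f' a‖⁻¹ • f' a :=
    Continuous.smul (Continuous.inv₀ (by fun_prop) fun a => (hpos a).ne') (by fun_prop)
  obtain ⟨F, hF⟩ := h A hA ⟨fun a => ⟨‖f' a‖⁻¹ • f' a, hmem a⟩, hcont.subtype_mk hmem⟩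
  have hFn : ∀ x, ‖(F x : EuclideanSpace ℝ (Fin (n + 1)))‖ = 1 := fun x =>
    mem_sphere_zero_iff_norm.1 (F x).2
  let g : C(X, EuclideanSpace ℝ (Fin (n + 1))) :=
    ⟨fun x => max ‖f' x‖ (ε / 2) • (F x : EuclideanSpace ℝ (Fin (n + 1))), by fun_prop⟩
  have hgn : ∀ x, ‖g x‖ = max ‖f' x‖ (ε / 2) := fun x => by
    change ‖max ‖f' x‖ (ε / 2) • (F x : EuclideanSpace ℝ (Fin (n + 1)))‖ = _
    rw [norm_smul, hFn, mul_one, Real.norm_of_nonneg (le_max_of_le_left (norm_nonneg _))]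
  have hgf : ∀ x, ‖g x - f' x‖ ≤ ε := by
    intro x
    by_cases hx : x ∈ A
    · have : g x = f' x := by
        change max ‖f' x‖ (ε / 2) • (F x : EuclideanSpace ℝ (Fin (n + 1))) = _
        have hx1 : (F x : EuclideanSpace ℝ (Fin (n + 1))) = ‖f' x‖⁻¹ • f' x :=
          congrArg Subtype.val (hF ⟨x, hx⟩)
        rw [max_eq_left hx, hx1]
        exact smul_inv_smul₀ (hpos ⟨x, hx⟩).ne' _
      simp [this, hε.le]
    · have hx' : ‖f' x‖ < ε / 2 := not_le.1 hx
      have h1 := norm_sub_le (g x) (f' x)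
      rw [hgn, max_eq_right hx'.le] at h1
      linarith
  refine ⟨⟨fun x => WithLp.ofLp (g x), by fun_prop⟩, fun x i => ?_, fun x _ h0 => ?_⟩
  · exact (PiLp.norm_apply_le (g x - f' x) i).trans (hgf x)
  · have : g x = 0 := (WithLp.ofLp_eq_zero 2).1 h0
    have h1 := hgn x
    rw [this, norm_zero] at h1
    have := le_max_right ‖f' x‖ (ε / 2)
    linarith

theorem dimLE_of_avoids_univ {X : Type u} [TopologicalSpace X] [NormalSpace X] {n : ℕ}
    (h : Avoids (univ : Set X) (Fin (n + 1))) : DimLE X n := by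
  intro A hA f
  obtain ⟨F₀, hF₀⟩ := ContinuousMap.exists_restrict_eq hA
    (⟨fun a => WithLp.ofLp (f a : EuclideanSpace ℝ (Fin (n + 1))), by fun_prop⟩ :
      C(A, Fin (n + 1) → ℝ))
  obtain ⟨G₀, hG₀, hG₀'⟩ := h F₀ (1 / (4 * (n + 1))) (by positivity)
  let F : C(X, EuclideanSpace ℝ (Fin (n + 1))) := ⟨fun x => WithLp.toLp 2 (F₀ x), by fun_prop⟩
  let G : C(X, EuclideanSpace ℝ (Fin (n + 1))) := ⟨fun x => WithLp.toLp 2 (G₀ x), by fun_prop⟩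
  have hFA : ∀ a : A, F a = f a := by
    intro a
    have := DFunLike.congr_fun hF₀ a
    rw [ContinuousMap.restrict_apply] at this
    change WithLp.toLp 2 (F₀ a) = _
    rw [this]
    rfl
  have hGne : ∀ x, G x ≠ 0 := fun x h0 => hG₀' x (mem_univ x) ((WithLp.toLp_eq_zero 2).1 h0)
  have hGF : ∀ x, ‖G x - F x‖ ≤ 1 / 4 := by
    intro x
    rw [← abs_of_nonneg (norm_nonneg (G x - F x)), ← abs_of_pos (by norm_num : (0 : ℝ) < 1 / 4),
      ← sq_le_sq, EuclideanSpace.norm_sq_eq]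
    have hi : ∀ i ∈ Finset.univ, ‖(G x - F x) i‖ ^ 2 ≤ (1 / (4 * (n + 1 : ℝ))) ^ 2 := fun i _ =>
      pow_le_pow_left₀ (norm_nonneg _) (hG₀ x i) 2
    refine (Finset.sum_le_sum hi).trans ?_
    rw [Finset.sum_const, Finset.card_univ, Fintype.card_fin, nsmul_eq_mul, div_pow, div_pow,
      mul_pow, ← mul_div_assoc, div_le_div_iff₀ (by positivity) (by positivity)]
    push_cast
    have : (0 : ℝ) ≤ n := n.cast_nonneg
    nlinarith
  let u : X → ℝ := fun x => max 0 (min 1 (2 * ‖F x‖ - 1))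
  have hu0 : ∀ x, 0 ≤ u x := fun x => le_max_left _ _
  have hu1 : ∀ x, u x ≤ 1 := fun x => max_le zero_le_one (min_le_left _ _)
  let H : C(X, EuclideanSpace ℝ (Fin (n + 1))) :=
    ⟨fun x => F x + (1 - u x) • (G x - F x), by simp only [u]; fun_prop⟩
  have hHne : ∀ x, H x ≠ 0 := by
    intro x h0
    have h0' : F x + (1 - u x) • (G x - F x) = 0 := h0
    by_cases hx : ‖F x‖ ≤ 1 / 2
    · have : u x = 0 := max_eq_left ((min_le_right _ _).trans (by linarith))
      rw [this, sub_zero, one_smul, add_sub_cancel] at h0'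
      exact hGne x h0'
    · have h1 : ‖F x‖ = (1 - u x) * ‖G x - F x‖ := by
        rw [eq_neg_of_add_eq_zero_left h0', norm_neg, norm_smul,
          Real.norm_of_nonneg (sub_nonneg.2 (hu1 x))]
        congr 2
        rw [← eq_neg_of_add_eq_zero_left h0']
      have h2 := hGF x
      have h3 := hu0 x
      have h4 := hu1 x
      have h5 := norm_nonneg (G x - F x)
      nlinarith
  have hmem : ∀ x, ‖H x‖⁻¹ • H x ∈
      Metric.sphere (0 : EuclideanSpace ℝ (Fin (n + 1))) 1 := fun x => by
    rw [mem_sphere_zero_iff_norm, norm_smul, norm_inv, norm_norm,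
      inv_mul_cancel₀ (norm_ne_zero_iff.2 (hHne x))]
  have hcont : Continuous fun x => ‖H x‖⁻¹ • H x :=
    Continuous.smul (Continuous.inv₀ (by fun_prop) fun x => norm_ne_zero_iff.2 (hHne x))
      (by fun_prop)
  refine ⟨⟨fun x => ⟨‖H x‖⁻¹ • H x, hmem x⟩, hcont.subtype_mk hmem⟩, fun a => Subtype.ext ?_⟩
  have hn : ‖F a‖ = 1 := by rw [hFA]; exact mem_sphere_zero_iff_norm.1 (f a).2
  have hua : u a = 1 := by simp only [u, hn]; norm_num
  have hHa : H a = f a := by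
    change F a + (1 - u a) • (G a - F a) = _
    rw [hua, sub_self, zero_smul, add_zero, hFA]
  change ‖H a‖⁻¹ • H a = _
  rw [hHa, mem_sphere_zero_iff_norm.1 (f a).2, inv_one, one_smul]

theorem avoids_univ_euclidean (n : ℕ) : Avoids (univ : Set (Fin n → ℝ)) (Fin (n + 1)) := by
  intro f ε hε
  obtain ⟨g, hg, hgf, -⟩ := f.continuous.exists_contDiff_approx 1 (ε := fun _ => ε / 2)
    continuous_const (fun _ => half_pos hε)
  obtain ⟨v, hv, hv'⟩ := (hg.dense_compl_range_of_finrank_lt_finrank (by simp)).exists_dist_lt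
    0 (half_pos hε)
  refine ⟨⟨fun x => g x - v, by have := hg.continuous; fun_prop⟩, fun x i => ?_,
    fun x _ h0 => hv ⟨x, sub_eq_zero.1 h0⟩⟩
  have h1 := (dist_le_pi_dist (g x) (f x) i).trans_lt (hgf x)
  have h2 := (dist_le_pi_dist 0 v i).trans_lt hv'
  rw [Real.dist_eq, abs_lt] at h1 h2
  simp only [Pi.zero_apply, ContinuousMap.coe_mk, Pi.sub_apply] at *
  rw [abs_le]
  constructor <;> linarith

theorem Avoids.exists_isClosed_disjoint {X : Type*} [TopologicalSpace X]
    [TopologicalSpace.MetrizableSpace X] [LocallyCompactSpace X] [SigmaCompactSpace X] {L : Set X}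
    (hL : IsClosed L) (h : ∀ k, ¬Avoids L (Fin k)) (m : ℕ) :
    ∃ A L' : Set X, IsClosed A ∧ A ⊆ L ∧ ¬Avoids A (Fin m) ∧
      (IsClosed L' ∧ ∀ k, ¬Avoids L' (Fin k)) ∧ L' ⊆ L ∧ Disjoint A L' := by
  let _ := TopologicalSpace.metrizableSpaceMetric X
  suffices ∃ A L' : Set X, IsClosed A ∧ A ⊆ L ∧ ¬Avoids A (Fin (m + 1)) ∧
      (IsClosed L' ∧ ∀ k, ¬Avoids L' (Fin k)) ∧ L' ⊆ L ∧ Disjoint A L' by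
    obtain ⟨A, L', h1, h2, h3, h4⟩ := this
    exact ⟨A, L', h1, h2, fun h => h3 (h.mono_card m.le_succ), h4⟩
  by_contra H
  have H' : ∀ A L' : Set X, IsClosed A → A ⊆ L → IsClosed L' → L' ⊆ L → Disjoint A L' →
      (∀ k, ¬Avoids L' (Fin k)) → Avoids A (Fin (m + 1)) := by
    intro A L' h1 h2 h3 h4 h5 h6
    by_contra h7
    exact H ⟨A, L', h1, h2, h7, ⟨h3, h6⟩, h4, h5⟩
  by_cases hx : ∃ x ∈ L, ∀ r > 0, ∀ k, ¬Avoids (Metric.closedBall x r ∩ L) (Fin k)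
  · obtain ⟨x, hxL, hx⟩ := hx
    have hT : ∀ j : ℕ, IsClosed {y | y ∈ L ∧ 1 / (j + 1 : ℝ) ≤ dist y x} := fun j =>
      hL.inter (isClosed_le continuous_const (continuous_id.dist continuous_const))
    have hxA : Avoids {x} (Fin (m + 1)) := Avoids.singleton x _
    refine h (m + 1) ((Avoids.iUnion_of_isClosed
      (F := fun j : ℕ => {x} ∪ {y | y ∈ L ∧ 1 / (j + 1 : ℝ) ≤ dist y x})
      (fun j => isClosed_singleton.union (hT j)) fun j =>
        hxA.union_of_isClosed isClosed_singleton (hT j) ?_).mono fun y hy => ?_)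
    · refine H' _ (Metric.closedBall x (1 / (j + 2)) ∩ L) (hT j) (fun y hy => hy.1)
        (Metric.isClosed_closedBall.inter hL) inter_subset_right ?_ (hx _ (by positivity))
      rw [Set.disjoint_left]
      intro y hy hy'
      have h1 : dist y x ≤ 1 / (j + 2) := hy'.1
      have h2 : 1 / (j + 2 : ℝ) < 1 / (j + 1) :=
        one_div_lt_one_div_of_lt (by positivity) (by linarith)
      exact absurd (hy.2.trans h1) (not_le.2 h2)
    · by_cases hyx : y = x
      · exact mem_iUnion.2 ⟨0, Or.inl hyx⟩
      · obtain ⟨j, hj⟩ := exists_nat_one_div_lt (dist_pos.2 hyx)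
        exact mem_iUnion.2 ⟨j, Or.inr ⟨hy, hj.le⟩⟩
  · push Not at hx
    have hK : ∀ K : Set X, IsCompact K → ∃ k, Avoids (K ∩ L) (Fin k) := by
      intro K hK
      obtain ⟨T, -, hT, k, hk⟩ := (hK.inter_right hL).induction_on
        (p := fun s => ∃ T, IsClosed T ∧ s ⊆ T ∧ ∃ k, Avoids T (Fin k))
        ⟨∅, isClosed_empty, subset_rfl, 0, fun f ε hε => ⟨f, by simp [hε.le], by simp⟩⟩
        (fun s t hst ⟨T, h1, h2, h3⟩ => ⟨T, h1, hst.trans h2, h3⟩)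
        (fun s t ⟨S, h1, h2, k, h3⟩ ⟨T, h4, h5, l, h6⟩ => ⟨S ∪ T, h1.union h4,
          union_subset_union h2 h5, max k l, (h3.mono_card (le_max_left k l)).union_of_isClosed h1 h4
            (h6.mono_card (le_max_right k l))⟩)
        (fun x hxK => by
          obtain ⟨r, hr, hk⟩ := hx x hxK.2
          exact ⟨(K ∩ L) ∩ Metric.closedBall x r,
            inter_mem_nhdsWithin _ (Metric.closedBall_mem_nhds x hr),
            Metric.closedBall x r ∩ L, Metric.isClosed_closedBall.inter hL,
            fun y hy => ⟨hy.2, hy.1.2⟩, hk⟩)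
      exact ⟨k, hk.mono hT⟩
    let E : CompactExhaustion X := default
    refine h (m + 1) ((Avoids.iUnion_of_isClosed (F := fun i => E i ∩ L)
      (fun i => (E.isCompact i).isClosed.inter hL) fun i => ?_).mono ?_)
    · refine H' _ (L \ interior (E (i + 1))) ((E.isCompact i).isClosed.inter hL) inter_subset_right
        (hL.sdiff isOpen_interior) sdiff_subset ?_ ?_
      · rw [Set.disjoint_left]
        exact fun x hx hx' => hx'.2 (E.subset_interior_succ i hx.1)
      · intro k hk
        obtain ⟨l, hl⟩ := hK _ (E.isCompact (i + 1))
        refine h (max k l) (((hk.mono_card (le_max_left k l)).union_of_isClosed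
          (hL.sdiff isOpen_interior) ((E.isCompact (i + 1)).isClosed.inter hL)
          (hl.mono_card (le_max_right k l))).mono fun x hx => ?_)
        by_cases hxi : x ∈ interior (E (i + 1))
        · exact Or.inr ⟨interior_subset hxi, hx⟩
        · exact Or.inl ⟨hx, hxi⟩
    · intro x hx
      obtain ⟨i, hi⟩ := E.exists_mem x
      exact mem_iUnion.2 ⟨i, hi, hx⟩

theorem exists_seq_disjoint_of_forall_not_avoids {X : Type*} [TopologicalSpace X]
    [TopologicalSpace.MetrizableSpace X] [LocallyCompactSpace X] [SigmaCompactSpace X]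
    (h : ∀ k, ¬Avoids (univ : Set X) (Fin k)) :
    ∃ (A : ℕ → Set X) (u : ℕ → C(X, ℝ)), (∀ m, ¬Avoids (A m) (Fin (2 ^ m))) ∧
      (∀ m x, |u m x| ≤ 1) ∧ (∀ m, ∀ x ∈ A m, u m x = 1) ∧
      ∀ m j, m ≠ j → ∀ x ∈ A m, u j x = 0 := by
  let _ := TopologicalSpace.metrizableSpaceMetric X
  choose! A' L' hA' hAL hA hL' hLL hd using
    fun (L : Set X) (hL : IsClosed L ∧ ∀ k, ¬Avoids L (Fin k)) =>
      Avoids.exists_isClosed_disjoint hL.1 hL.2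
  let B : ℕ → Set X := fun n => Nat.rec univ (fun k L => L' L (2 ^ k)) n
  have hB : ∀ n, IsClosed (B n) ∧ ∀ k, ¬Avoids (B n) (Fin k) := by
    intro n
    induction n with
    | zero => exact ⟨isClosed_univ, h⟩
    | succ n ih => exact hL' (B n) ih _
  have hBa : Antitone B := antitone_nat_of_succ_le fun n => hLL (B n) (hB n) _
  let A : ℕ → Set X := fun n => A' (B n) (2 ^ n)
  have hAc : ∀ n, IsClosed (A n) := fun n => hA' _ (hB n) _
  have hAB : ∀ n, A n ⊆ B n := fun n => hAL _ (hB n) _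
  have hAd : ∀ n, Disjoint (A n) (B (n + 1)) := fun n => hd _ (hB n) _
  have hAA : ∀ m j, j < m → Disjoint (A m) (A j) := fun m j hjm =>
    ((hAd j).mono_right ((hAB m).trans (hBa hjm))).symm
  have hu : ∀ m, ∃ u : C(X, ℝ), EqOn u 0 ((⋃ j ∈ Finset.range m, A j) ∪ B (m + 1)) ∧
      EqOn u 1 (A m) ∧ ∀ x, u x ∈ Icc (0 : ℝ) 1 := fun m =>
    exists_continuous_zero_one_of_isClosed
      ((isClosed_biUnion_finset fun j _ => hAc j).union (hB (m + 1)).1) (hAc m) <| by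
        refine Disjoint.union_left ?_ (hAd m).symm
        simp only [Set.disjoint_iUnion_left, Finset.mem_range]
        exact fun j hj => (hAA m j hj).symm
  choose u hu0 hu1 hu using hu
  refine ⟨A, u, fun m => hA _ (hB m) _, fun m x => abs_le.2 ⟨by linarith [(hu m x).1], (hu m x).2⟩,
    fun m x hx => hu1 m hx, fun m j hmj x hx => hu0 j ?_⟩
  rcases lt_or_gt_of_ne hmj with hmj | hmj
  · exact Or.inl (mem_biUnion (Finset.mem_coe.2 (Finset.mem_range.2 hmj)) hx)
  · exact Or.inr (hBa hmj (hAB m hx))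

theorem exists_forall_zero_of_not_avoids {X : Type*} [TopologicalSpace X] {A : Set X} {ι : Type}
    (h : ¬Avoids A ι) :
    ∃ c : C(X, ι → ℝ), (∀ x i, |c x i| ≤ 1) ∧
      ∀ g : C(X, ι → ℝ), (∀ x ∈ A, ∀ i, |g x i - c x i| ≤ 1) → ∃ x ∈ A, g x = 0 := by
  unfold Avoids at h
  push Not at h
  obtain ⟨f, ε, hε, h⟩ := h
  let t : ℝ → ℝ := fun y => max (-1) (min 1 y)
  have htc : Continuous t := by fun_prop
  have ht : ∀ y, |t y| ≤ 1 := fun y =>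
    abs_le.2 ⟨le_max_left _ _, max_le (by norm_num) (min_le_left _ _)⟩
  have ht' : ∀ y, |y| ≤ 1 → t y = y := fun y hy => by
    simp only [t, min_eq_right (abs_le.1 hy).2, max_eq_right (abs_le.1 hy).1]
  refine ⟨⟨fun x i => t (f x i / ε), by fun_prop⟩, fun x i => ht _, fun g hg => ?_⟩
  obtain ⟨x, hx, h0⟩ := h ⟨fun x i => f x i + ε * t (g x i - t (f x i / ε)), by fun_prop⟩ <| by
    intro x i
    change |f x i + ε * t (g x i - t (f x i / ε)) - f x i| ≤ ε
    rw [add_sub_cancel_left, abs_mul, abs_of_pos hε]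
    exact mul_le_of_le_one_right hε.le (ht _)
  refine ⟨x, hx, funext fun i => ?_⟩
  have h1 : f x i + ε * t (g x i - t (f x i / ε)) = 0 := congrFun h0 i
  have h2 : f x i / ε = -t (g x i - t (f x i / ε)) := by
    field_simp
    linarith
  have h3 : t (f x i / ε) = f x i / ε := ht' _ (by rw [h2, abs_neg]; exact ht _)
  have h4 : |g x i - t (f x i / ε)| ≤ 1 := hg x hx i
  rw [ht' _ h4] at h2
  simp only [Pi.zero_apply]
  linarith

theorem exists_cantor_family_of_forall_not_avoids {X : Type*} [TopologicalSpace X]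
    [TopologicalSpace.MetrizableSpace X] [LocallyCompactSpace X] [SigmaCompactSpace X]
    (h : ∀ k, ¬Avoids (univ : Set X) (Fin k)) :
    ∃ F : (ℕ → Bool) → C(X, ℝ), ∀ (m : ℕ) (φ : C(X, Fin m → ℝ)),
      {α | ∃ g : C(Fin m → ℝ, ℝ), ∀ x, F α x = g (φ x)}.Countable := by
  obtain ⟨A, u, hA, hu, hu1, hu0⟩ := exists_seq_disjoint_of_forall_not_avoids h
  choose c hc hcA using fun m => exists_forall_zero_of_not_avoids
    (A := A m) (ι := Fin m → Bool) fun h => hA m <|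
      h.of_injective (Fintype.equivFinOfCardEq (by simp)) (Equiv.injective _)
  let v : (ℕ → Bool) → ℕ → C(X, ℝ) := fun α m =>
    ⟨fun x => u m x * c m x fun k => α k, by fun_prop⟩
  have hv : ∀ α m x, |v α m x| ≤ 1 := fun α m x => by
    change |u m x * c m x fun k => α k| ≤ 1
    rw [abs_mul]
    exact mul_le_one₀ (hu m x) (abs_nonneg _) (hc m x _)
  let F : (ℕ → Bool) → C(X, ℝ) := fun α =>
    ⟨fun x => ∑' m, (1 / 2 : ℝ) ^ m * v α m x, continuous_tsum_half_pow_mul (v α) (hv α)⟩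
  have hF : ∀ α m, ∀ x ∈ A m, F α x = (1 / 2 : ℝ) ^ m * c m x fun k => α k := by
    intro α m x hx
    change ∑' m, (1 / 2 : ℝ) ^ m * (u m x * c m x fun k => α k) = _
    rw [tsum_eq_single m, hu1 m x hx, one_mul]
    intro j hj
    rw [hu0 m j hj.symm x hx, zero_mul, mul_zero]
  refine ⟨F, fun n φ => Set.Finite.countable ?_⟩
  by_contra hinf
  obtain ⟨t, ht, htn⟩ := Set.Infinite.exists_subset_card_eq hinf (n + 1)
  let e := (Finset.equivFinOfCardEq htn).symm
  have hα : ∀ i, ∃ g : C(Fin n → ℝ, ℝ), ∀ x, F (e i) x = g (φ x) := fun i => ht (e i).2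
  choose g hg using hα
  obtain ⟨m, hm⟩ : ∃ m : ℕ, ∀ i j, (∀ k < m, (e i).1 k = (e j).1 k) → i = j := by
    refine Filter.Eventually.exists (f := Filter.atTop) ?_
    rw [Filter.eventually_all]
    intro i
    rw [Filter.eventually_all]
    intro j
    by_cases hij : i = j
    · exact Filter.Eventually.of_forall fun _ _ => hij
    · have : (e i).1 ≠ (e j).1 := fun h => hij (e.injective (Subtype.ext h))
      obtain ⟨k, hk⟩ := Function.ne_iff.1 this
      filter_upwards [Filter.eventually_gt_atTop k] with m hm hm'
      exact absurd (hm' k hm) hk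
  let r : Fin (n + 1) → (Fin m → Bool) := fun i k => (e i).1 k
  have hr : Function.Injective r := fun i j hij =>
    hm i j fun k hk => congrFun hij ⟨k, hk⟩
  obtain ⟨G, hG, hG0⟩ := avoids_univ_euclidean n ⟨fun y i => g i y, by fun_prop⟩ ((1 / 2 : ℝ) ^ m)
    (by positivity)
  obtain ⟨x, hx, h0⟩ := hcA m
    ⟨fun x => Function.extend r (fun i => (2 : ℝ) ^ m * G (φ x) i) (c m x), by
      refine continuous_pi fun k => ?_
      by_cases hk : ∃ i, r i = k
      · obtain ⟨i, rfl⟩ := hk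
        simp only [hr.extend_apply]
        fun_prop
      · simp only [Function.extend_apply' _ _ _ hk]
        fun_prop⟩ <| by
    intro x hx k
    change |Function.extend r (fun i => (2 : ℝ) ^ m * G (φ x) i) (c m x) k - c m x k| ≤ 1
    by_cases hk : ∃ i, r i = k
    · obtain ⟨i, rfl⟩ := hk
      rw [hr.extend_apply]
      have h1 : |G (φ x) i - g i (φ x)| ≤ (1 / 2 : ℝ) ^ m := hG (φ x) i
      rw [← hg i x, hF _ m x hx] at h1
      have h2 : (2 : ℝ) ^ m * G (φ x) i - c m x (r i) =
          2 ^ m * (G (φ x) i - (1 / 2 : ℝ) ^ m * c m x (r i)) := by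
        rw [mul_sub, ← mul_assoc, ← mul_pow]
        norm_num
      rw [h2, abs_mul, abs_of_pos (by positivity)]
      refine (mul_le_mul_of_nonneg_left h1 (by positivity)).trans ?_
      rw [← mul_pow]
      norm_num
    · simp [Function.extend_apply' _ _ _ hk]
  refine hG0 (φ x) (mem_univ _) (funext fun i => ?_)
  have h1 : Function.extend r (fun i => (2 : ℝ) ^ m * G (φ x) i) (c m x) (r i) = 0 :=
    congrFun h0 (r i)
  rw [hr.extend_apply] at h1
  simpa using h1

theorem Avoids.exists_approx_card_le {X : Type*} [TopologicalSpace X] {n : ℕ}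
    (h : Avoids (univ : Set X) (Fin (n + 1))) {C : Set X} (hC : IsCompact C) {G : Set ℝ}
    (hG : IsClosed G) (hGc : G.Countable) {q : ℕ} (f : C(X, Fin q → ℝ)) {ε : ℝ} (hε : 0 < ε) :
    ∃ (g : C(X, Fin q → ℝ)) (δ : ℝ), 0 < δ ∧ (∀ x i, |g x i - f x i| ≤ ε) ∧
      ∀ x ∈ C, ∀ s : Finset (Fin q), (∀ j ∈ s, ∃ t ∈ G, |g x j - t| < δ) → s.card ≤ n := by
  have := hGc.to_subtype
  let W : (Fin (n + 1) ↪ Fin q) → Set (Fin q → ℝ) := fun e => {y | ∃ i, y (e i) ∉ G}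
  have hWo : ∀ e, IsOpen (W e) := fun e => by
    have : W e = ⋃ i, (fun y : Fin q → ℝ => y (e i)) ⁻¹' Gᶜ := by
      ext y
      simp [W]
    rw [this]
    exact isOpen_iUnion fun i => hG.isOpen_compl.preimage (continuous_apply _)
  obtain ⟨g, hg, hgW⟩ := exists_approx_forall_mem_of_isCompact
    (J := (Fin (n + 1) ↪ Fin q) × (Fin (n + 1) → G)) (K := fun _ => C) (fun _ => hC)
    (W := fun p => {y | (fun i => y (p.1 i)) ≠ fun i => (p.2 i : ℝ)})
    (fun p => isOpen_ne_fun (by fun_prop) continuous_const) (fun ⟨e, v⟩ f ε hε => by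
      obtain ⟨g, hg, hg'⟩ := h ⟨fun x i => f x (e i) - v i, by fun_prop⟩ ε hε
      refine ⟨⟨fun x => Function.extend e (fun i => g x i + v i) (f x), ?_⟩, ?_, ?_⟩
      · refine continuous_pi fun k => ?_
        by_cases hk : ∃ i, e i = k
        · obtain ⟨i, rfl⟩ := hk
          simp only [e.injective.extend_apply]
          fun_prop
        · simp only [Function.extend_apply' _ _ _ hk]
          fun_prop
      · intro x k
        by_cases hk : ∃ i, e i = k
        · obtain ⟨i, rfl⟩ := hk
          have := hg x i
          simp only [ContinuousMap.coe_mk, e.injective.extend_apply] at this ⊢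
          rwa [← sub_add, sub_add_eq_add_sub] at this
        · simp [Function.extend_apply' _ _ _ hk, hε.le]
      · intro x hx h0
        refine hg' x (mem_univ x) (funext fun i => ?_)
        have := congrFun h0 i
        simpa [e.injective.extend_apply] using this) f hε
  have hgW' : g '' C ⊆ ⋂ e, W e := by
    rintro _ ⟨x, hx, rfl⟩
    refine mem_iInter.2 fun e => ?_
    by_contra hxe
    have hxe' : ∀ i, g x (e i) ∈ G := fun i => by
      by_contra hi
      exact hxe ⟨i, hi⟩
    exact hgW ⟨e, fun i => ⟨_, hxe' i⟩⟩ x hx rfl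
  obtain ⟨δ, hδ, hδW⟩ := (hC.image g.continuous).exists_thickening_subset_open
    (isOpen_iInter_of_finite hWo) hgW'
  refine ⟨g, δ, hδ, hg, fun x hx s hs => ?_⟩
  by_contra! hsn
  obtain ⟨s', hs', hs'n⟩ := Finset.exists_subset_card_eq hsn
  let e : Fin (n + 1) ↪ Fin q := (s'.orderEmbOfFin hs'n).toEmbedding
  have he : ∀ i, ∃ t ∈ G, |g x (e i) - t| < δ := fun i =>
    hs _ (hs' (s'.orderEmbOfFin_mem hs'n i))
  choose t htG ht using he
  have hy : Function.extend e t (g x) ∈ Metric.thickening δ (g '' C) := by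
    refine Metric.mem_thickening_iff.2 ⟨g x, mem_image_of_mem _ hx, ?_⟩
    rw [dist_pi_lt_iff hδ]
    intro k
    by_cases hk : ∃ i, e i = k
    · obtain ⟨i, rfl⟩ := hk
      rw [e.injective.extend_apply, dist_comm]
      exact ht i
    · simp [Function.extend_apply' _ _ _ hk, hδ]
  obtain ⟨i, hi⟩ := mem_iInter.1 (hδW hy) e
  rw [e.injective.extend_apply] at hi
  exact hi (htG i)

/-- A continuous staircase with `M` steps of height `1 / M`, each of width `δ`. -/
def staircase (M : ℕ) (δ : ℝ) (t : ℝ) : ℝ :=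
  ∑ k ∈ Finset.range M, 1 / M * max 0 (min 1 ((t - (k + 1 / 2) / M) / δ))

theorem continuous_staircase (M : ℕ) (δ : ℝ) : Continuous (staircase M δ) := by
  unfold staircase
  fun_prop

section staircase

variable {M : ℕ} {δ t : ℝ}

theorem ramp_of_nonpos (hδ : 0 < δ) {y : ℝ} (h : y ≤ 0) : max 0 (min 1 (y / δ)) = 0 :=
  max_eq_left ((min_le_right _ _).trans (div_nonpos_of_nonpos_of_nonneg h hδ.le))

theorem ramp_of_le (hδ : 0 < δ) {y : ℝ} (h : δ ≤ y) : max 0 (min 1 (y / δ)) = 1 := by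
  rw [min_eq_left ((one_le_div hδ).2 h), max_eq_right zero_le_one]

theorem staircase_nonneg : 0 ≤ staircase M δ t :=
  Finset.sum_nonneg fun _ _ => mul_nonneg (by positivity) (le_max_left _ _)

theorem staircase_le_one : staircase M δ t ≤ 1 := by
  have : ∀ k ∈ Finset.range M,
      1 / M * max 0 (min 1 ((t - (k + 1 / 2) / M) / δ)) ≤ (1 / M : ℝ) := fun k _ =>
    mul_le_of_le_one_right (by positivity) (max_le zero_le_one (min_le_left _ _))
  refine (Finset.sum_le_sum this).trans ?_
  rw [Finset.sum_const, Finset.card_range, nsmul_eq_mul]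
  rw [mul_one_div]
  exact div_self_le_one _

theorem staircase_eq_zero (hM : 0 < M) (hδ : 0 < δ) (h : t ≤ 1 / (2 * M)) :
    staircase M δ t = 0 := by
  have hM' : (0 : ℝ) < M := Nat.cast_pos.2 hM
  refine Finset.sum_eq_zero fun k _ => ?_
  rw [ramp_of_nonpos hδ, mul_zero]
  have : (1 : ℝ) / (2 * M) ≤ (k + 1 / 2) / M := by
    rw [div_le_div_iff₀ (by positivity) hM']
    have : (0 : ℝ) ≤ k * M := by positivity
    nlinarith
  linarith

theorem staircase_eq_one (hM : 0 < M) (hδ : 0 < δ) (h : 1 - 1 / (2 * M) + δ ≤ t) :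
    staircase M δ t = 1 := by
  have hM' : (0 : ℝ) < M := Nat.cast_pos.2 hM
  have : ∀ k ∈ Finset.range M,
      1 / M * max 0 (min 1 ((t - (k + 1 / 2) / M) / δ)) = (1 / M : ℝ) := fun k hk => by
    have hk' : (k + 1 : ℝ) ≤ M := by exact_mod_cast Finset.mem_range.1 hk
    rw [ramp_of_le hδ, mul_one]
    have : (k + 1 / 2 : ℝ) / M ≤ 1 - 1 / (2 * M) := by
      rw [div_le_iff₀ hM']
      have : (1 - 1 / (2 * M : ℝ)) * M = M - 1 / 2 := by field_simp
      linarith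
    linarith
  unfold staircase
  rw [Finset.sum_congr rfl this, Finset.sum_const, Finset.card_range, nsmul_eq_mul,
    mul_one_div_cancel hM'.ne']

theorem exists_staircase_eq (hδ : 0 < δ)
    (h : ∀ k < M, ¬|t - (((k : ℕ) : ℝ) + 1 / 2) / M| < δ) :
    ∃ k ≤ M, staircase M δ t = (k : ℝ) / M := by
  refine ⟨((Finset.range M).filter fun k : ℕ => δ ≤ t - (k + 1 / 2) / M).card,
    (Finset.card_filter_le _ _).trans (Finset.card_range M).le, ?_⟩
  unfold staircase
  rw [Finset.card_filter, ← Finset.mul_sum, one_div, inv_mul_eq_div]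
  push_cast
  congr 1
  refine Finset.sum_congr rfl fun k hk => ?_
  have hk' := h k (Finset.mem_range.1 hk)
  rw [abs_lt, not_and_or] at hk'
  split_ifs with hkt
  · exact ramp_of_le hδ hkt
  · refine ramp_of_nonpos hδ ?_
    rcases hk' with h' | h' <;> linarith

theorem abs_staircase_sub_le (hM : 0 < M) (hδ : 0 < δ) (hδM : δ ≤ 1 / (2 * M)) (h0 : 0 ≤ t)
    (h1 : t ≤ 1) : |staircase M δ t - t| ≤ 1 / M := by
  have hM' : (0 : ℝ) < M := Nat.cast_pos.2 hM
  rcases h1.eq_or_lt with rfl | h1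
  · rw [staircase_eq_one hM hδ (by linarith)]
    simp
  set k := ⌊t * M⌋₊ with hk
  have hk1 : (k : ℝ) ≤ t * M := Nat.floor_le (by positivity)
  have hk2 : t * M < k + 1 := Nat.lt_floor_add_one _
  have hkM : k < M := by
    have : (k : ℝ) < M := by nlinarith
    exact_mod_cast this
  have hδM' : δ * M ≤ 1 / 2 := by
    have := mul_le_mul_of_nonneg_right hδM hM'.le
    field_simp at this ⊢
    linarith
  have key : staircase M δ t = 1 / M * (k + max 0 (min 1 ((t - (k + 1 / 2) / M) / δ))) := by
    unfold staircase
    rw [← Finset.mul_sum, ← Finset.sum_range_add_sum_Ico _ (Nat.succ_le_of_lt hkM),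
      Finset.sum_range_succ, Finset.sum_congr (g := fun _ => (1 : ℝ)) rfl fun j hj => ?_,
      Finset.sum_eq_zero (s := Finset.Ico _ _) fun j hj => ?_]
    · simp
    · refine ramp_of_nonpos hδ ?_
      have : (k + 1 : ℝ) ≤ j := by exact_mod_cast (Finset.mem_Ico.1 hj).1
      rw [sub_nonpos, le_div_iff₀ hM']
      linarith
    · refine ramp_of_le hδ ?_
      have : (j + 1 : ℝ) ≤ k := by exact_mod_cast Finset.mem_range.1 hj
      rw [le_sub_iff_add_le, ← le_sub_iff_add_le', div_le_iff₀ hM', sub_mul]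
      linarith
  have hr0 : 0 ≤ max 0 (min 1 ((t - (k + 1 / 2) / M) / δ)) := le_max_left _ _
  have hr1 : max 0 (min 1 ((t - (k + 1 / 2) / M) / δ)) ≤ 1 := max_le zero_le_one (min_le_left _ _)
  set ρ := max 0 (min 1 ((t - (k + 1 / 2) / M) / δ))
  have : staircase M δ t - t = (k + ρ - t * M) / M := by
    rw [key]
    field_simp
  rw [this, abs_div, abs_of_pos hM']
  refine div_le_div_of_nonneg_right (abs_le.2 ⟨?_, ?_⟩) hM'.le <;> linarith

end staircase

/-- The grid `{k / M : k ∈ ℕ}` together with everything outside `(0, 1)`. -/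
def gridSet (M : ℕ) : Set ℝ := {y | y ≤ 0 ∨ 1 ≤ y ∨ ∃ k : ℕ, y = k / M}

theorem infDist_gridSet {M k : ℕ} (hM : 0 < M) (hk : k ≤ M) {a : ℝ} (ha : 0 ≤ a)
    (haM : a ≤ 1 / (2 * M)) : Metric.infDist (min (k / M + a) (1 - a)) (gridSet M) = a := by
  have hM' : (0 : ℝ) < M := Nat.cast_pos.2 hM
  have h2 : 1 / (M : ℝ) = 2 * (1 / (2 * M)) := by field_simp
  have hM1 : (1 : ℝ) / M ≤ 1 := (div_le_one hM').2 (by exact_mod_cast hM)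
  have hk0 : (0 : ℝ) ≤ k / M := by positivity
  obtain ⟨b, hb, hbk⟩ : ∃ b, min (k / M + a) (1 - a) = b ∧ |b - k / M| = a := by
    refine ⟨_, rfl, ?_⟩
    rcases hk.eq_or_lt with rfl | hk
    · rw [div_self hM'.ne', min_eq_right (by linarith)]
      rw [sub_sub_cancel_left, abs_neg, abs_of_nonneg ha]
    · have : (k + 1 : ℝ) / M ≤ 1 := (div_le_one hM').2 (by exact_mod_cast hk)
      rw [add_div] at this
      rw [min_eq_left (by linarith), add_sub_cancel_left, abs_of_nonneg ha]
  have hb0 : a ≤ b := hb ▸ le_min (by linarith) (by linarith)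
  have hb1 : b ≤ 1 - a := hb ▸ min_le_right _ _
  rw [hb]
  refine le_antisymm ?_ ((Metric.le_infDist
    ⟨0, show (0 : ℝ) ∈ gridSet M from Or.inl le_rfl⟩).2 fun y hy => ?_)
  · have := Metric.infDist_le_dist_of_mem (x := b) (s := gridSet M) (y := k / M)
      (Or.inr (Or.inr ⟨k, rfl⟩))
    rwa [Real.dist_eq, hbk] at this
  · rw [Real.dist_eq]
    rcases hy with hy | hy | ⟨l, rfl⟩
    · exact le_trans (by linarith) (le_abs_self _)
    · exact le_trans (by linarith) (neg_le_abs _)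
    · rcases eq_or_ne k l with rfl | hkl
      · exact hbk.ge
      · have h1 : 1 / (M : ℝ) ≤ |(k / M : ℝ) - l / M| := by
          rw [← sub_div, abs_div, abs_of_pos hM']
          refine div_le_div_of_nonneg_right ?_ hM'.le
          have : (1 : ℤ) ≤ |(k : ℤ) - l| := Int.one_le_abs (by omega)
          exact_mod_cast this
        have h3 := abs_sub_le (k / M : ℝ) b (l / M)
        rw [abs_sub_comm (k / M : ℝ) b, hbk] at h3
        linarith

/-- `φ` takes values in the unit cube, is `0` on `Z₀` and `1` on `Z₁`. -/
def IsAdmissible {X : Type*} {q : ℕ} (Z₀ Z₁ : Set X) (φ : X → Fin q → ℝ) : Prop :=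
  (∀ x j, φ x j ∈ Icc (0 : ℝ) 1) ∧ (∀ x ∈ Z₀, ∀ j, φ x j = 0) ∧ ∀ x ∈ Z₁, ∀ j, φ x j = 1

theorem Avoids.exists_approx_isAdmissible {X : Type*} [TopologicalSpace X] {n q : ℕ}
    (h : Avoids (univ : Set X) (Fin (n + 1))) (hq : 0 < q) {Z₀ Z₁ C : Set X} (hC : IsCompact C)
    (hcov : ∀ x, x ∈ C ∨ x ∈ Z₀ ∨ x ∈ Z₁) {f : C(X, ℝ)} (hf : ∀ x, f x ∈ Icc (0 : ℝ) 1)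
    (hfZ : ∀ x ∈ Z₀ ∪ Z₁, f x = 0) {φ : C(X, Fin q → ℝ)} (hφ : IsAdmissible Z₀ Z₁ φ) {ε : ℝ}
    (hε : 0 < ε) :
    ∃ ψ : C(X, Fin q → ℝ), (∀ x j, |ψ x j - φ x j| ≤ ε) ∧ IsAdmissible Z₀ Z₁ ψ ∧
      ∃ g : C(ℝ, ℝ), (∀ t, |g t| ≤ 1 / q) ∧ (∀ t, t ≤ 0 ∨ 1 ≤ t → g t = 0) ∧
        ∀ x, |f x - ∑ j, g (ψ x j)| ≤ n / q := by
  classical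
  have hq' : (0 : ℝ) < q := Nat.cast_pos.2 hq
  obtain ⟨N, hN⟩ := exists_nat_one_div_lt (show 0 < ε / 4 by positivity)
  obtain ⟨M, hM⟩ : ∃ M : ℕ, M = N + 1 := ⟨_, rfl⟩
  have hM0 : 0 < M := by omega
  have hM' : (0 : ℝ) < M := Nat.cast_pos.2 hM0
  have hMε : 1 / (M : ℝ) < ε / 4 := by rw [hM]; exact_mod_cast hN
  obtain ⟨κ, hκ⟩ : ∃ κ : ℝ, κ = 1 / (2 * M) := ⟨_, rfl⟩
  have hκ0 : 0 < κ := by rw [hκ]; positivity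
  have hκM : 1 / (M : ℝ) = 2 * κ := by rw [hκ]; field_simp
  have hκ1 : 2 * κ ≤ 1 := by rw [← hκM]; exact (div_le_one hM').2 (by exact_mod_cast hM0)
  have hGfin : ((fun k : ℕ => ((k : ℝ) + 1 / 2) / M) '' (Finset.range M : Set ℕ)).Finite :=
    (Finset.finite_toSet _).image _
  obtain ⟨p, δ₀, hδ₀, hp, hbad⟩ := h.exists_approx_card_le hC hGfin.isClosed hGfin.countable φ
    (half_pos hκ0)
  obtain ⟨δ, hδ⟩ : ∃ δ, δ = min δ₀ (κ / 2) := ⟨_, rfl⟩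
  have hδ0 : 0 < δ := by rw [hδ]; exact lt_min hδ₀ (half_pos hκ0)
  have hδδ : δ ≤ δ₀ := hδ ▸ min_le_left _ _
  have hδκ : δ ≤ κ / 2 := hδ ▸ min_le_right _ _
  let s : X → Fin q → ℝ := fun x j => staircase M δ (p x j)
  have hs0 : ∀ x j, 0 ≤ s x j := fun x j => staircase_nonneg
  have hs1 : ∀ x j, s x j ≤ 1 := fun x j => staircase_le_one
  have hsz : ∀ x j, p x j ≤ κ → s x j = 0 := fun x j hx =>
    staircase_eq_zero hM0 hδ0 (hκ ▸ hx)
  have hso : ∀ x j, 1 - κ + δ ≤ p x j → s x j = 1 := fun x j hx =>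
    staircase_eq_one hM0 hδ0 (hκ ▸ hx)
  have hsφ : ∀ x j, |s x j - φ x j| ≤ 3 * κ := by
    intro x j
    have h1 := abs_le.1 (hp x j)
    have h2 := hφ.1 x j
    rcases lt_or_ge (p x j) 0 with h3 | h3
    · rw [hsz x j (by linarith), abs_le]
      constructor <;> linarith [h2.1, h2.2]
    rcases lt_or_ge 1 (p x j) with h4 | h4
    · rw [hso x j (by linarith), abs_le]
      constructor <;> linarith [h2.1, h2.2]
    have h5 := abs_le.1 (abs_staircase_sub_le hM0 hδ0 (by rw [← hκ]; linarith) h3 h4)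
    change |staircase M δ (p x j) - φ x j| ≤ _
    rw [abs_le]
    constructor <;> linarith [h5.1, h5.2]
  have hs : ∀ j, Continuous fun x => s x j := fun j =>
    (continuous_staircase M δ).comp (by fun_prop)
  let ψ : C(X, Fin q → ℝ) := ⟨fun x j => min (s x j + κ * f x) (1 - κ * f x), by
    refine continuous_pi fun j => ?_
    have := hs j
    fun_prop⟩
  have hκf0 : ∀ x, 0 ≤ κ * f x := fun x => mul_nonneg hκ0.le (hf x).1
  have hκf1 : ∀ x, κ * f x ≤ κ := fun x => mul_le_of_le_one_right hκ0.le (hf x).2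
  have hψ : ∀ x j, ψ x j = min (s x j + κ * f x) (1 - κ * f x) := fun x j => rfl
  have hψad : IsAdmissible Z₀ Z₁ ψ := by
    refine ⟨fun x j => ⟨?_, ?_⟩, fun x hx j => ?_, fun x hx j => ?_⟩
    · rw [hψ]
      exact le_min (add_nonneg (hs0 x j) (hκf0 x)) (by linarith [hκf1 x])
    · rw [hψ]
      exact (min_le_right _ _).trans (by linarith [hκf0 x])
    · have h1 := abs_le.1 (hp x j)
      rw [hφ.2.1 x hx j] at h1
      rw [hψ, hfZ x (Or.inl hx), hsz x j (by linarith)]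
      simp
    · have h1 := abs_le.1 (hp x j)
      rw [hφ.2.2 x hx j] at h1
      rw [hψ, hfZ x (Or.inr hx), hso x j (by linarith)]
      simp
  let g : C(ℝ, ℝ) := ⟨fun t => min (1 / q) (Metric.infDist t (gridSet M) / (κ * q)), by
    have := Metric.continuous_infDist_pt (gridSet M)
    fun_prop⟩
  have hg0 : ∀ t, 0 ≤ g t := fun t =>
    le_min (by positivity) (div_nonneg Metric.infDist_nonneg (by positivity))
  have hg1 : ∀ t, g t ≤ 1 / q := fun t => min_le_left _ _
  have hgz : ∀ t, t ≤ 0 ∨ 1 ≤ t → g t = 0 := by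
    intro t ht
    change min (1 / q : ℝ) (Metric.infDist t (gridSet M) / (κ * q)) = 0
    rw [Metric.infDist_zero_of_mem, zero_div, min_eq_right (by positivity)]
    exact ht.imp_right Or.inl
  refine ⟨ψ, fun x j => ?_, hψad, g, fun t => ?_, hgz, fun x => ?_⟩
  · have h1 := abs_le.1 (hsφ x j)
    have h2 : ψ x j ≤ s x j + κ * f x := min_le_left _ _
    have h3 : s x j - κ * f x ≤ ψ x j :=
      le_min (by linarith [hκf0 x]) (by linarith [hs1 x j])
    rw [abs_le]
    constructor <;> linarith [hκf1 x]
  · rw [abs_of_nonneg (hg0 t)]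
    exact hg1 t
  · by_cases hxC : x ∈ C
    · let B : Finset (Fin q) := Finset.univ.filter fun j =>
        ∃ t ∈ (fun k : ℕ => ((k : ℝ) + 1 / 2) / M) '' (Finset.range M : Set ℕ), |p x j - t| < δ₀
      have hB : B.card ≤ n := hbad x hxC B fun j hj => (Finset.mem_filter.1 hj).2
      have hterm : ∀ j, |f x / q - g (ψ x j)| ≤ if j ∈ B then 1 / (q : ℝ) else 0 := by
        intro j
        split_ifs with hj
        · have h1 : f x / q ≤ 1 / q := div_le_div_of_nonneg_right (hf x).2 hq'.le
          have h2 : 0 ≤ f x / q := div_nonneg (hf x).1 hq'.le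
          rw [abs_le]
          constructor <;> linarith [hg0 (ψ x j), hg1 (ψ x j)]
        · obtain ⟨k, hk, hsk⟩ := exists_staircase_eq (M := M) (t := p x j) hδ0 fun k hk hlt =>
            hj (Finset.mem_filter.2 ⟨Finset.mem_univ _, _, ⟨k, by simpa using hk, rfl⟩,
              hlt.trans_le hδδ⟩)
          have h1 : Metric.infDist (ψ x j) (gridSet M) = κ * f x := by
            change Metric.infDist (min (staircase M δ (p x j) + κ * f x) (1 - κ * f x)) _ = _
            rw [hsk]
            exact infDist_gridSet hM0 hk (hκf0 x) (hκ ▸ hκf1 x)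
          have h2 : g (ψ x j) = f x / q := by
            change min (1 / q : ℝ) (Metric.infDist (ψ x j) (gridSet M) / (κ * q)) = _
            rw [h1, mul_div_mul_left _ _ hκ0.ne',
              min_eq_right (div_le_div_of_nonneg_right (hf x).2 hq'.le)]
          simp [h2]
      have hsum : f x - ∑ j, g (ψ x j) = ∑ j, (f x / q - g (ψ x j)) := by
        rw [Finset.sum_sub_distrib, Finset.sum_const, Finset.card_univ, Fintype.card_fin,
          nsmul_eq_mul, mul_div_cancel₀ _ hq'.ne']
      rw [hsum]
      refine (Finset.abs_sum_le_sum_abs _ _).trans ((Finset.sum_le_sum fun j _ => hterm j).trans ?_)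
      rw [Finset.sum_ite_mem, Finset.univ_inter, Finset.sum_const, nsmul_eq_mul, mul_one_div]
      exact div_le_div_of_nonneg_right (by exact_mod_cast hB) hq'.le
    · have hxZ : x ∈ Z₀ ∪ Z₁ := (hcov x).resolve_left hxC
      have h1 : ∀ j, g (ψ x j) = 0 := fun j => by
        refine hgz _ ?_
        rcases hxZ with hx | hx
        · exact Or.inl (hψad.2.1 x hx j).le
        · exact Or.inr (hψad.2.2 x hx j).ge
      rw [hfZ x hxZ, Finset.sum_eq_zero fun j _ => h1 j]
      simp only [sub_zero, abs_zero]
      positivity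

theorem exists_countable_dense_unit_interval_vanishing {X : Type*} [TopologicalSpace X] [T2Space X]
    [SecondCountableTopology X] {Z C : Set X} (hC : IsCompact C) (hcov : ∀ x, x ∈ C ∨ x ∈ Z) :
    ∃ D : Set C(X, ℝ), D.Countable ∧
      (∀ d ∈ D, (∀ x, d x ∈ Icc (0 : ℝ) 1) ∧ ∀ x ∈ Z, d x = 0) ∧
      ∀ f : C(X, ℝ), (∀ x, f x ∈ Icc (0 : ℝ) 1) → (∀ x ∈ Z, f x = 0) → ∀ ε > 0,
        ∃ d ∈ D, ∀ x, |f x - d x| ≤ ε := by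
  have : CompactSpace C := isCompact_iff_compactSpace.1 hC
  let T : Set C(X, ℝ) := {f | (∀ x, f x ∈ Icc (0 : ℝ) 1) ∧ ∀ x ∈ Z, f x = 0}
  obtain ⟨t, htT, htc, ht⟩ := (TopologicalSpace.IsSeparable.of_separableSpace
    (ContinuousMap.restrict C '' T)).exists_countable_dense_subset
  have hex : ∀ s ∈ t, ∃ f ∈ T, f.restrict C = s := fun s hs => htT hs
  choose! r hrT hr using hex
  refine ⟨r '' t, htc.image r, ?_, fun f hf hfZ ε hε => ?_⟩
  · rintro _ ⟨s, hs, rfl⟩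
    exact hrT s hs
  · obtain ⟨s, hs, hfs⟩ := Metric.mem_closure_iff.1
      (ht (mem_image_of_mem (ContinuousMap.restrict C) (show f ∈ T from ⟨hf, hfZ⟩))) ε hε
    refine ⟨r s, mem_image_of_mem r hs, fun x => ?_⟩
    rcases hcov x with hx | hx
    · have h1 := (ContinuousMap.dist_apply_le_dist (⟨x, hx⟩ : C)).trans hfs.le
      rw [← hr s hs] at h1
      exact h1
    · rw [hfZ x hx, (hrT s hs).2 x hx]
      simpa using hε.le

theorem isOpen_setOf_exists_approx {X : Type*} [TopologicalSpace X] {q : ℕ} (f : C(X, ℝ)) :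
    IsOpen {φ : BoundedContinuousFunction X (Fin q → ℝ) | ∃ g : Fin q → C(ℝ, ℝ),
      (∀ j t, |g j t| ≤ 1) ∧ (∀ j t, t ≤ 0 ∨ 1 ≤ t → g j t = 0) ∧
        ∃ c < (1 / 3 : ℝ), ∀ x, |f x - ∑ j, g j (φ x j)| ≤ c} := by
  rw [isOpen_iff_mem_nhds]
  rintro φ ⟨g, hg1, hg0, c, hc, hcf⟩
  obtain ⟨c', hcc', hc'⟩ := exists_between hc
  obtain ⟨ε, hε, hεq⟩ : ∃ ε > 0, q * ε ≤ c' - c := by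
    refine ⟨(c' - c) / (q + 1), div_pos (sub_pos.2 hcc') (by positivity), ?_⟩
    rw [← mul_div_assoc, div_le_iff₀ (by positivity)]
    nlinarith [sub_pos.2 hcc', (Nat.cast_nonneg q : (0 : ℝ) ≤ q)]
  have hev : ∀ j, ∀ᶠ ψ : BoundedContinuousFunction X (Fin q → ℝ) in 𝓝 φ,
      ∀ x, |g j (φ x j) - g j (ψ x j)| ≤ ε := by
    intro j
    have hu : UniformContinuous (g j) := by
      refine HasCompactSupport.uniformContinuous_of_continuous
        (HasCompactSupport.intro (isCompact_Icc (a := (0 : ℝ)) (b := 1)) fun t ht => ?_)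
        (g j).continuous
      refine hg0 j t ?_
      by_contra! hlt
      exact ht ⟨hlt.1.le, hlt.2.le⟩
    obtain ⟨δ, hδ, hδg⟩ := Metric.uniformContinuous_iff.1 hu ε hε
    filter_upwards [Metric.ball_mem_nhds φ hδ] with ψ hψ x
    refine (hδg ?_).le
    refine (dist_le_pi_dist (φ x) (ψ x) j).trans_lt ?_
    rw [dist_comm]
    exact (BoundedContinuousFunction.dist_coe_le_dist x).trans_lt hψ
  filter_upwards [Filter.eventually_all.2 hev] with ψ hψ
  refine ⟨g, hg1, hg0, c', hc', fun x => ?_⟩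
  have h1 : |∑ j, (g j (φ x j) - g j (ψ x j))| ≤ q * ε := by
    refine (Finset.abs_sum_le_sum_abs _ _).trans ((Finset.sum_le_sum fun j _ => hψ j x).trans ?_)
    simp
  rw [Finset.sum_sub_distrib] at h1
  have h2 := abs_le.1 (hcf x)
  have h3 := abs_le.1 h1
  rw [abs_le]
  constructor <;> linarith

theorem Avoids.exists_isAdmissible_forall_approx {X : Type*} [TopologicalSpace X]
    [TopologicalSpace.MetrizableSpace X] [SecondCountableTopology X] {n q : ℕ}
    (h : Avoids (univ : Set X) (Fin (n + 1))) (hq : 4 * n < q) {Z₀ Z₁ C : Set X} (hC : IsCompact C)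
    (hcov : ∀ x, x ∈ C ∨ x ∈ Z₀ ∨ x ∈ Z₁) (hZ₀ : IsClosed Z₀) (hZ₁ : IsClosed Z₁)
    (hZ : Disjoint Z₀ Z₁) :
    ∃ φ : C(X, Fin q → ℝ), IsAdmissible Z₀ Z₁ φ ∧ ∀ f : C(X, ℝ), (∀ x, |f x| ≤ 1) →
      (∀ x ∈ Z₀ ∪ Z₁, f x = 0) → ∃ g : Fin q → C(ℝ, ℝ),
        (∀ j t, |g j t| ≤ 2) ∧ (∀ j t, t ≤ 0 ∨ 1 ≤ t → g j t = 0) ∧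
          ∀ x, |f x - ∑ j, g j (φ x j)| ≤ 3 / 4 := by
  have hq0 : 0 < q := by omega
  have hq' : (0 : ℝ) < q := Nat.cast_pos.2 hq0
  obtain ⟨D, hDc, hDT, hD⟩ := exists_countable_dense_unit_interval_vanishing hC
    (Z := Z₀ ∪ Z₁) hcov
  let P : Set (BoundedContinuousFunction X (Fin q → ℝ)) := {φ | IsAdmissible Z₀ Z₁ φ}
  have hev : ∀ x j, Continuous fun φ : BoundedContinuousFunction X (Fin q → ℝ) => φ x j :=
    fun x j => (continuous_apply j).comp (continuous_eval_const x)
  have hP : IsClosed P := by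
    have : P = {φ | ∀ x j, φ x j ∈ Icc (0 : ℝ) 1} ∩ ({φ | ∀ x ∈ Z₀, ∀ j, φ x j = 0} ∩
        {φ | ∀ x ∈ Z₁, ∀ j, φ x j = 1}) := rfl
    rw [this]
    simp only [Set.ofPred_forall]
    refine IsClosed.inter ?_ (IsClosed.inter ?_ ?_)
    · exact isClosed_iInter fun x => isClosed_iInter fun j => isClosed_Icc.preimage (hev x j)
    · exact isClosed_iInter fun x => isClosed_iInter fun _ => isClosed_iInter fun j =>
        isClosed_eq (hev x j) continuous_const
    · exact isClosed_iInter fun x => isClosed_iInter fun _ => isClosed_iInter fun j =>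
        isClosed_eq (hev x j) continuous_const
  have hPc : CompleteSpace P := hP.completeSpace_coe
  have hPne : Nonempty P := by
    obtain ⟨u, hu0, hu1, hu⟩ := exists_continuous_zero_one_of_isClosed hZ₀ hZ₁ hZ
    refine ⟨⟨BoundedContinuousFunction.ofNormedAddCommGroup (fun x _ => u x) (by fun_prop) 1
      fun x => (pi_norm_le_iff_of_nonneg zero_le_one).2 fun j => ?_, ?_⟩⟩
    · rw [Real.norm_of_nonneg (hu x).1]
      exact (hu x).2
    · exact ⟨fun x j => hu x, fun x hx j => hu0 hx, fun x hx j => hu1 hx⟩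
  let Ω : C(X, ℝ) → Set P := fun f => Subtype.val ⁻¹' {φ | ∃ g : Fin q → C(ℝ, ℝ),
      (∀ j t, |g j t| ≤ 1) ∧ (∀ j t, t ≤ 0 ∨ 1 ≤ t → g j t = 0) ∧
        ∃ c < (1 / 3 : ℝ), ∀ x, |f x - ∑ j, g j (φ x j)| ≤ c}
  have hΩo : ∀ d ∈ D, IsOpen (Ω d) := fun d _ =>
    (isOpen_setOf_exists_approx d).preimage continuous_subtype_val
  have hΩd : ∀ d ∈ D, Dense (Ω d) := by
    intro d hd
    rw [Metric.dense_iff]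
    rintro ⟨φ, hφ⟩ ε hε
    obtain ⟨ψ, hψφ, hψ, g, hg1, hg0, hg⟩ := h.exists_approx_isAdmissible hq0 hC hcov (hDT d hd).1
      (hDT d hd).2 (φ := φ.toContinuousMap) hφ (half_pos hε)
    let ψ' : BoundedContinuousFunction X (Fin q → ℝ) :=
      BoundedContinuousFunction.ofNormedAddCommGroup ψ ψ.continuous 1
        fun x => (pi_norm_le_iff_of_nonneg zero_le_one).2 fun j => by
          rw [Real.norm_of_nonneg (hψ.1 x j).1]
          exact (hψ.1 x j).2
    refine ⟨⟨ψ', hψ⟩, ?_, fun _ => g, fun _ t => (hg1 t).trans ?_, fun _ => hg0, n / q, ?_, hg⟩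
    · refine Metric.mem_ball.2 (lt_of_le_of_lt ?_ (half_lt_self hε))
      change dist ψ' φ ≤ ε / 2
      rw [BoundedContinuousFunction.dist_le (half_pos hε).le]
      exact fun x => (dist_pi_le_iff (half_pos hε).le).2 fun j => hψφ x j
    · rw [div_le_one hq']
      exact_mod_cast hq0
    · rw [div_lt_iff₀ hq']
      have : (4 * n : ℝ) < q := by exact_mod_cast hq
      linarith
  obtain ⟨⟨φ, hφ⟩, hφΩ⟩ := (dense_biInter_of_isOpen hΩo hDc hΩd).nonempty
  have key : ∀ f : C(X, ℝ), (∀ x, f x ∈ Icc (0 : ℝ) 1) → (∀ x ∈ Z₀ ∪ Z₁, f x = 0) →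
      ∃ g : Fin q → C(ℝ, ℝ), (∀ j t, |g j t| ≤ 1) ∧ (∀ j t, t ≤ 0 ∨ 1 ≤ t → g j t = 0) ∧
        ∀ x, |f x - ∑ j, g j (φ x j)| ≤ 3 / 8 := by
    intro f hf hfZ
    obtain ⟨d, hd, hfd⟩ := hD f hf hfZ (1 / 24) (by norm_num)
    obtain ⟨g, hg1, hg0, c, hc, hg⟩ := mem_iInter₂.1 hφΩ d hd
    refine ⟨g, hg1, hg0, fun x => ?_⟩
    have h1 := abs_le.1 (hfd x)
    have h2 : |d x - ∑ j, g j (φ x j)| ≤ c := hg x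
    rw [abs_le] at h2 ⊢
    constructor <;> linarith [h1.1, h1.2, h2.1, h2.2]
  refine ⟨φ.toContinuousMap, hφ, fun f hf hfZ => ?_⟩
  obtain ⟨g, hg1, hg0, hg⟩ := key ⟨fun x => max (f x) 0, by fun_prop⟩
    (fun x => ⟨le_max_right _ _, max_le (abs_le.1 (hf x)).2 zero_le_one⟩)
    fun x hx => by simp [hfZ x hx]
  obtain ⟨g', hg'1, hg'0, hg'⟩ := key ⟨fun x => max (-f x) 0, by fun_prop⟩
    (fun x => ⟨le_max_right _ _, max_le (by linarith [(abs_le.1 (hf x)).1]) zero_le_one⟩)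
    fun x hx => by simp [hfZ x hx]
  refine ⟨fun j => g j - g' j, fun j t => ?_, fun j t ht => ?_, fun x => ?_⟩
  · have h1 := abs_le.1 (hg1 j t)
    have h2 := abs_le.1 (hg'1 j t)
    rw [ContinuousMap.sub_apply, abs_le]
    constructor <;> linarith
  · rw [ContinuousMap.sub_apply, hg0 j t ht, hg'0 j t ht, sub_zero]
  · have h1 : |max (f x) 0 - ∑ j, g j (φ x j)| ≤ 3 / 8 := hg x
    have h2 : |max (-f x) 0 - ∑ j, g' j (φ x j)| ≤ 3 / 8 := hg' x
    have h3 : f x = max (f x) 0 - max (-f x) 0 := by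
      rcases le_total 0 (f x) with h | h
      · rw [max_eq_left h, max_eq_right (by linarith), sub_zero]
      · rw [max_eq_right h, max_eq_left (by linarith)]
        ring
    change |f x - ∑ j, (g j (φ x j) - g' j (φ x j))| ≤ 3 / 4
    rw [Finset.sum_sub_distrib]
    rw [abs_le] at h1 h2 ⊢
    constructor <;> linarith [h1.1, h1.2, h2.1, h2.2]

theorem exists_eq_sum_comp_of_forall_approx {X : Type*} [TopologicalSpace X] {q : ℕ} {Z : Set X}
    {φ : C(X, Fin q → ℝ)} (hφ : ∀ x ∈ Z, ∀ j, φ x j ≤ 0 ∨ 1 ≤ φ x j)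
    (happ : ∀ f : C(X, ℝ), (∀ x, |f x| ≤ 1) → (∀ x ∈ Z, f x = 0) → ∃ g : Fin q → C(ℝ, ℝ),
      (∀ j t, |g j t| ≤ 2) ∧ (∀ j t, t ≤ 0 ∨ 1 ≤ t → g j t = 0) ∧
        ∀ x, |f x - ∑ j, g j (φ x j)| ≤ 3 / 4)
    {f : C(X, ℝ)} (hf : ∀ x, |f x| ≤ 1) (hfZ : ∀ x ∈ Z, f x = 0) :
    ∃ g : Fin q → C(ℝ, ℝ), (∀ j t, t ≤ 0 ∨ 1 ≤ t → g j t = 0) ∧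
      ∀ x, f x = ∑ j, g j (φ x j) := by
  have happ' : ∀ f : C(X, ℝ), ∃ g : Fin q → C(ℝ, ℝ), (∀ x, |f x| ≤ 1) → (∀ x ∈ Z, f x = 0) →
      (∀ j t, |g j t| ≤ 2) ∧ (∀ j t, t ≤ 0 ∨ 1 ≤ t → g j t = 0) ∧
        ∀ x, |f x - ∑ j, g j (φ x j)| ≤ 3 / 4 := by
    intro f
    by_cases h : (∀ x, |f x| ≤ 1) ∧ ∀ x ∈ Z, f x = 0
    · obtain ⟨g, hg⟩ := happ f h.1 h.2
      exact ⟨g, fun _ _ => hg⟩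
    · exact ⟨0, fun h1 h2 => absurd ⟨h1, h2⟩ h⟩
  choose G hG using happ'
  let next : C(X, ℝ) → C(X, ℝ) := fun f =>
    ⟨fun x => (4 / 3 : ℝ) * (f x - ∑ j, G f j (φ x j)), by fun_prop⟩
  let F : ℕ → C(X, ℝ) := fun k => next^[k] f
  have hFs : ∀ k x, F (k + 1) x = (4 / 3 : ℝ) * (F k x - ∑ j, G (F k) j (φ x j)) := fun k x => by
    simp only [F, Function.iterate_succ_apply']
    rfl
  have hF : ∀ k, (∀ x, |F k x| ≤ 1) ∧ ∀ x ∈ Z, F k x = 0 := by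
    intro k
    induction k with
    | zero => exact ⟨hf, hfZ⟩
    | succ k ih =>
      obtain ⟨-, h2, h3⟩ := hG (F k) ih.1 ih.2
      refine ⟨fun x => ?_, fun x hx => ?_⟩
      · rw [hFs, abs_mul, abs_of_pos (by norm_num : (0 : ℝ) < 4 / 3)]
        linarith [h3 x]
      · rw [hFs, ih.2 x hx, Finset.sum_eq_zero fun j _ => h2 j _ (hφ x hx j)]
        simp
  have hg2 : ∀ k j t, |G (F k) j t| ≤ 2 := fun k => (hG (F k) (hF k).1 (hF k).2).1
  have hg0 : ∀ k j t, t ≤ 0 ∨ 1 ≤ t → G (F k) j t = 0 :=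
    fun k => (hG (F k) (hF k).1 (hF k).2).2.1
  have hsumm : Summable fun k : ℕ => (3 / 4 : ℝ) ^ k * 2 :=
    (summable_geometric_of_lt_one (by norm_num) (by norm_num)).mul_right 2
  have hbound : ∀ k j t, ‖(3 / 4 : ℝ) ^ k * G (F k) j t‖ ≤ (3 / 4 : ℝ) ^ k * 2 := fun k j t => by
    rw [norm_mul, Real.norm_of_nonneg (by positivity)]
    exact mul_le_mul_of_nonneg_left (hg2 k j t) (by positivity)
  refine ⟨fun j => ⟨fun t => ∑' k, (3 / 4 : ℝ) ^ k * G (F k) j t,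
    continuous_tsum (fun k => by fun_prop) hsumm fun k t => hbound k j t⟩, fun j t ht => ?_,
    fun x => ?_⟩
  · change ∑' k, (3 / 4 : ℝ) ^ k * G (F k) j t = 0
    simp [hg0 _ j t ht]
  · have hs : ∀ j, HasSum (fun k => (3 / 4 : ℝ) ^ k * G (F k) j (φ x j))
        (∑' k, (3 / 4 : ℝ) ^ k * G (F k) j (φ x j)) := fun j =>
      (Summable.of_norm_bounded hsumm fun k => hbound k j _).hasSum
    have h1 := (hasSum_sum fun j (_ : j ∈ Finset.univ) => hs j).tendsto_sum_nat
    have h2 : ∀ K, ∑ k ∈ Finset.range K, ∑ j, (3 / 4 : ℝ) ^ k * G (F k) j (φ x j) =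
        f x - (3 / 4 : ℝ) ^ K * F K x := by
      intro K
      induction K with
      | zero => simp [F]
      | succ K ih =>
        rw [Finset.sum_range_succ, ih, hFs, ← Finset.mul_sum, pow_succ]
        ring
    have h3 : Filter.Tendsto (fun K => (3 / 4 : ℝ) ^ K * F K x) Filter.atTop (𝓝 0) := by
      refine squeeze_zero_norm (fun K => ?_)
        (tendsto_pow_atTop_nhds_zero_of_lt_one (by norm_num : (0 : ℝ) ≤ 3 / 4) (by norm_num))
      rw [norm_mul, Real.norm_of_nonneg (by positivity)]
      exact mul_le_of_le_one_right (by positivity) ((hF K).1 x)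
    refine tendsto_nhds_unique ?_ h1
    simp only [h2]
    simpa using h3.const_sub (f x)

theorem Avoids.exists_isAdmissible_forall_eq {X : Type*} [TopologicalSpace X]
    [TopologicalSpace.MetrizableSpace X] [SecondCountableTopology X] {n q : ℕ}
    (h : Avoids (univ : Set X) (Fin (n + 1))) (hq : 4 * n < q) {Z₀ Z₁ C : Set X} (hC : IsCompact C)
    (hcov : ∀ x, x ∈ C ∨ x ∈ Z₀ ∨ x ∈ Z₁) (hZ₀ : IsClosed Z₀) (hZ₁ : IsClosed Z₁)
    (hZ : Disjoint Z₀ Z₁) :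
    ∃ φ : C(X, Fin q → ℝ), IsAdmissible Z₀ Z₁ φ ∧ ∀ f : C(X, ℝ), (∀ x ∈ Z₀ ∪ Z₁, f x = 0) →
      ∃ g : Fin q → C(ℝ, ℝ), (∀ j t, t ≤ 0 ∨ 1 ≤ t → g j t = 0) ∧
        ∀ x, f x = ∑ j, g j (φ x j) := by
  obtain ⟨φ, hφ, happ⟩ := h.exists_isAdmissible_forall_approx hq hC hcov hZ₀ hZ₁ hZ
  refine ⟨φ, hφ, fun f hfZ => ?_⟩
  obtain ⟨a, ha⟩ := hC.exists_bound_of_continuousOn f.continuous.continuousOn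
  have hb : 0 < max a 1 := lt_max_of_lt_right one_pos
  have hf : ∀ x, |f x| ≤ max a 1 := fun x => by
    rcases hcov x with hx | hx
    · exact (ha x hx).trans (le_max_left _ _)
    · rw [hfZ x hx, abs_zero]
      exact hb.le
  obtain ⟨g, hg0, hg⟩ := exists_eq_sum_comp_of_forall_approx (Z := Z₀ ∪ Z₁) (φ := φ)
    (fun x hx j => hx.imp (fun hx => (hφ.2.1 x hx j).le) fun hx => (hφ.2.2 x hx j).ge) happ
    (f := (max a 1)⁻¹ • f) (fun x => by
      rw [ContinuousMap.smul_apply, smul_eq_mul, abs_mul, abs_of_pos (inv_pos.2 hb),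
        inv_mul_le_iff₀ hb, mul_one]
      exact hf x) (fun x hx => by simp [hfZ x hx])
  refine ⟨fun j => (max a 1) • g j, fun j t ht => by simp [hg0 j t ht], fun x => ?_⟩
  have := hg x
  rw [ContinuousMap.smul_apply, smul_eq_mul, inv_mul_eq_iff_eq_mul₀ hb.ne', Finset.mul_sum] at this
  exact this

theorem exists_continuousMap_eq_sum_range {X : Type*} [TopologicalSpace X] (u : ℕ → C(X, ℝ))
    (O : ℕ → Set X) (hO : ∀ x, ∃ k, O k ∈ 𝓝 x) (hu : ∀ k i, k ≤ i → ∀ x ∈ O k, u i x = 0) :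
    ∃ s : C(X, ℝ), ∀ k, ∀ x ∈ O k, s x = ∑ i ∈ Finset.range k, u i x := by
  have key : ∀ k, ∀ x ∈ O k, ∑ᶠ i, u i x = ∑ i ∈ Finset.range k, u i x := fun k x hx => by
    refine finsum_eq_sum_of_support_subset _ fun i hi => ?_
    rw [Finset.mem_coe, Finset.mem_range]
    by_contra! hki
    exact hi (hu k i hki x hx)
  refine ⟨⟨fun x => ∑ᶠ i, u i x, continuous_finsum (fun i => (u i).continuous) fun x => ?_⟩, key⟩
  obtain ⟨k, hk⟩ := hO x
  refine ⟨O k, hk, (Finset.range k).finite_toSet.subset ?_⟩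
  rintro i ⟨y, hyi, hyk⟩
  rw [Finset.mem_coe, Finset.mem_range]
  by_contra! hki
  exact hyi (hu k i hki y hyk)

theorem exists_continuousMap_isCompact_sublevel (X : Type*) [TopologicalSpace X] [T2Space X]
    [NormalSpace X] [LocallyCompactSpace X] [SigmaCompactSpace X] :
    ∃ r : C(X, ℝ), (∀ x, 0 ≤ r x) ∧ ∀ c, IsCompact {x | r x ≤ c} := by
  let E : CompactExhaustion X := default
  have hu : ∀ i, ∃ u : C(X, ℝ), EqOn u 0 (E i) ∧ EqOn u 1 (interior (E (i + 1)))ᶜ ∧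
      ∀ x, u x ∈ Icc (0 : ℝ) 1 := fun i =>
    exists_continuous_zero_one_of_isClosed (E.isCompact i).isClosed isOpen_interior.isClosed_compl
      (Set.disjoint_compl_right_iff_subset.2 (E.subset_interior_succ i))
  choose u hu0 hu1 hu using hu
  obtain ⟨r, hr⟩ := exists_continuousMap_eq_sum_range u (fun k => E k)
    (fun x => by
      obtain ⟨k, hk⟩ := E.exists_mem x
      exact ⟨k + 1, mem_interior_iff_mem_nhds.1 (E.subset_interior_succ k hk)⟩)
    fun k i hki x hx => hu0 i (E.subset hki hx)
  have hr0 : ∀ x, 0 ≤ r x := fun x => by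
    obtain ⟨k, hk⟩ := E.exists_mem x
    rw [hr k x hk]
    exact Finset.sum_nonneg fun i _ => (hu i x).1
  refine ⟨r, hr0, fun c => ?_⟩
  obtain ⟨N, hN⟩ := exists_nat_gt c
  refine (E.isCompact N).of_isClosed_subset (isClosed_le r.continuous continuous_const) fun x hx => ?_
  by_contra hxN
  obtain ⟨k, hk⟩ := E.exists_mem x
  have hNk : N ≤ k := by
    by_contra! hkN
    exact hxN (E.subset hkN.le hk)
  have h1 : (N : ℝ) ≤ r x := by
    rw [hr k x hk]
    calc (N : ℝ) = ∑ i ∈ Finset.range N, u i x := by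
          rw [Finset.sum_congr rfl fun i hi => hu1 i (x := x) fun hxi =>
            hxN (E.subset (Finset.mem_range.1 hi) (interior_subset hxi))]
          simp
      _ ≤ _ := Finset.sum_le_sum_of_subset_of_nonneg (Finset.range_mono hNk)
          fun i _ _ => (hu i x).1
  exact absurd (hN.trans_le h1) (not_lt.2 hx)

theorem Avoids.exists_forall_eq_sum_comp {X : Type*} [TopologicalSpace X]
    [TopologicalSpace.MetrizableSpace X] [SecondCountableTopology X] {n q : ℕ}
    (h : Avoids (univ : Set X) (Fin (n + 1))) (hq : 4 * n < q) {r : C(X, ℝ)} (hr0 : ∀ x, 0 ≤ r x)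
    (hr : ∀ c, IsCompact {x | r x ≤ c}) :
    ∃ φ : Fin q → C(X, ℝ), ∀ f : C(X, ℝ), (∀ x (k : ℤ), r x = k → f x = 0) →
      ∃ g : Fin q → C(ℝ, ℝ), ∀ x, f x = ∑ j, g j (φ j x) := by
  have hΦ : ∀ i : ℕ, ∃ φ : C(X, Fin q → ℝ), IsAdmissible {x | r x ≤ i} {x | (i + 1 : ℝ) ≤ r x} φ ∧
      ∀ f : C(X, ℝ), (∀ x ∈ {x | r x ≤ i} ∪ {x | (i + 1 : ℝ) ≤ r x}, f x = 0) →
      ∃ g : Fin q → C(ℝ, ℝ), (∀ j t, t ≤ 0 ∨ 1 ≤ t → g j t = 0) ∧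
        ∀ x, f x = ∑ j, g j (φ x j) := by
    intro i
    refine h.exists_isAdmissible_forall_eq hq (hr (i + 1)) (fun x => ?_)
      (isClosed_le r.continuous continuous_const) (isClosed_le continuous_const r.continuous) ?_
    · exact (le_total (r x) (i + 1)).imp_right Or.inr
    · rw [Set.disjoint_left]
      intro x (hx : r x ≤ i) (hx' : (i + 1 : ℝ) ≤ r x)
      linarith
  choose Φ hΦ hΦf using hΦ
  have hs : ∀ j, ∃ s : C(X, ℝ), ∀ k : ℕ, ∀ x ∈ {x | r x < k},
      s x = ∑ i ∈ Finset.range k, Φ i x j := fun j => by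
    refine exists_continuousMap_eq_sum_range (fun i => ⟨fun x => Φ i x j, by fun_prop⟩) _
      (fun x => ?_) fun k i hki x hx => ?_
    · obtain ⟨k, hk⟩ := exists_nat_gt (r x)
      exact ⟨k, (isOpen_lt r.continuous continuous_const).mem_nhds hk⟩
    · refine (hΦ i).2.1 x ?_ j
      have hx' : r x < k := hx
      have : (k : ℝ) ≤ i := by exact_mod_cast hki
      exact (hx'.le.trans this : r x ≤ i)
  choose φ hφ using hs
  have hring : ∀ x, ∃ i : ℕ, (i : ℝ) ≤ r x ∧ r x < i + 1 ∧ ∀ j, φ j x = i + Φ i x j := by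
    intro x
    refine ⟨⌊r x⌋₊, Nat.floor_le (hr0 x), Nat.lt_floor_add_one _, fun j => ?_⟩
    rw [hφ j (⌊r x⌋₊ + 1) x (by exact_mod_cast Nat.lt_floor_add_one (r x)),
      Finset.sum_range_succ, Finset.sum_congr rfl fun i hi => (hΦ i).2.2 x ?_ j]
    · simp
    · have : (i + 1 : ℝ) ≤ ⌊r x⌋₊ := by exact_mod_cast Finset.mem_range.1 hi
      exact this.trans (Nat.floor_le (hr0 x))
  refine ⟨φ, fun f hf => ?_⟩
  have hfi : ∀ i : ℕ, Continuous (({x | (i : ℝ) ≤ r x ∧ r x ≤ i + 1} : Set X).indicator f) := by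
    intro i
    refine continuous_indicator (fun x hx => ?_) f.continuous.continuousOn
    have h1 : x ∈ r ⁻¹' frontier (Icc (i : ℝ) (i + 1)) :=
      r.continuous.frontier_preimage_subset _ hx
    rw [frontier_Icc (by linarith)] at h1
    rcases h1 with h1 | h1
    · exact hf x i (by exact_mod_cast h1)
    · exact hf x (i + 1) (by exact_mod_cast h1)
  have hfi0 : ∀ i : ℕ, ∀ x ∈ {x | r x ≤ i} ∪ {x | (i + 1 : ℝ) ≤ r x},
      (⟨_, hfi i⟩ : C(X, ℝ)) x = 0 := by
    intro i x hx
    refine Set.indicator_apply_eq_zero.2 fun hx' => ?_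
    rcases hx with hx | hx
    · exact hf x i (by exact_mod_cast le_antisymm hx hx'.1)
    · exact hf x (i + 1) (by exact_mod_cast le_antisymm hx'.2 hx)
  choose g hg0 hg using fun i => hΦf i _ (hfi0 i)
  have hG : ∀ j, ∃ s : C(ℝ, ℝ), ∀ k : ℕ, ∀ t ∈ Iio (k : ℝ),
      s t = ∑ i ∈ Finset.range k, g i j (t - i) := fun j => by
    refine exists_continuousMap_eq_sum_range (fun i => ⟨fun t => g i j (t - i), by fun_prop⟩) _
      (fun t => ?_) fun k i hki t ht => ?_
    · obtain ⟨k, hk⟩ := exists_nat_gt t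
      exact ⟨k, Iio_mem_nhds hk⟩
    · have ht' : t < k := ht
      have : (k : ℝ) ≤ i := by exact_mod_cast hki
      exact hg0 i j _ (Or.inl (by linarith))
  choose G hG using hG
  refine ⟨G, fun x => ?_⟩
  obtain ⟨i, hi, hi', hφi⟩ := hring x
  have h1 : f x = ∑ j, g i j (Φ i x j) := by
    rw [← hg i x]
    exact (Set.indicator_of_mem (show x ∈ {x | (i : ℝ) ≤ r x ∧ r x ≤ i + 1} from ⟨hi, hi'.le⟩)
      f).symm
  rw [h1]
  refine Finset.sum_congr rfl fun j _ => ?_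
  have hx := (hΦ i).1 x j
  rw [hφi, hG j (i + 2) _ (by push_cast; rw [mem_Iio]; linarith [hx.2]),
    Finset.sum_eq_single_of_mem i (Finset.mem_range.2 (by omega)), add_sub_cancel_left]
  intro l _ hli
  refine hg0 l j _ ?_
  rcases lt_or_gt_of_ne hli with hl | hl
  · have : (l + 1 : ℝ) ≤ i := by exact_mod_cast hl
    exact Or.inr (by linarith [hx.1])
  · have : (i + 1 : ℝ) ≤ l := by exact_mod_cast hl
    exact Or.inl (by linarith [hx.2])

theorem Avoids.exists_finite_isBasicFamily {X : Type u} [TopologicalSpace X]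
    [TopologicalSpace.MetrizableSpace X] [SecondCountableTopology X] [LocallyCompactSpace X]
    {n : ℕ} (h : Avoids (univ : Set X) (Fin (n + 1))) :
    ∃ Φ : Set C(X, ℝ), Φ.Finite ∧ IsBasicFamily Φ := by
  obtain ⟨r, hr0, hr⟩ := exists_continuousMap_isCompact_sublevel X
  obtain ⟨φ, hφ⟩ := h.exists_forall_eq_sum_comp (q := 4 * n + 1) (by omega) hr0 hr
  obtain ⟨ψ, hψ⟩ := h.exists_forall_eq_sum_comp (q := 4 * n + 1) (by omega)
    (r := ⟨fun x => r x + 1 / 2, by fun_prop⟩)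
    (fun x => add_nonneg (hr0 x) (by norm_num)) fun c => by
      simpa only [ContinuousMap.coe_mk, ← le_sub_iff_add_le] using hr (c - 1 / 2)
  refine ⟨range φ ∪ range ψ, (finite_range φ).union (finite_range ψ), fun f => ?_⟩
  obtain ⟨g, hg⟩ := hφ ⟨fun x => f x * Real.sin (Real.pi * r x) ^ 2, by fun_prop⟩ fun x k hk => by
    change f x * Real.sin (Real.pi * r x) ^ 2 = 0
    rw [hk, mul_comm Real.pi, Real.sin_int_mul_pi]
    simp
  obtain ⟨g', hg'⟩ := hψ ⟨fun x => f x * Real.cos (Real.pi * r x) ^ 2, by fun_prop⟩ fun x k hk => by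
    change f x * Real.cos (Real.pi * r x) ^ 2 = 0
    have hk' : r x + 1 / 2 = k := hk
    have : Real.pi * r x = k * Real.pi - Real.pi / 2 := by
      rw [← hk']
      ring
    rw [this, Real.cos_sub_pi_div_two, Real.sin_int_mul_pi]
    simp
  refine ⟨_, Fin.append φ ψ, Fin.append g g', fun i => ?_, fun x => ?_⟩
  · refine Fin.addCases (fun i => ?_) (fun i => ?_) i
    · rw [Fin.append_left]
      exact Or.inl (mem_range_self i)
    · rw [Fin.append_right]
      exact Or.inr (mem_range_self i)
  · rw [Fin.sum_univ_add]
    simp only [Fin.append_left, Fin.append_right]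
    rw [← hg x, ← hg' x]
    change f x = f x * Real.sin (Real.pi * r x) ^ 2 + f x * Real.cos (Real.pi * r x) ^ 2
    rw [← mul_add, Real.sin_sq_add_cos_sq, mul_one]

theorem isBasicFamily_univ (X : Type u) [TopologicalSpace X] :
    IsBasicFamily (Set.univ : Set C(X, ℝ)) := fun f =>
  ⟨1, fun _ => f, fun _ => ContinuousMap.id ℝ, fun _ => Set.mem_univ _, fun x => by simp⟩

theorem IsBasicFamily.basicCard_le {X : Type u} [TopologicalSpace X] {Φ : Set C(X, ℝ)}
    (hΦ : IsBasicFamily Φ) : basicCard X ≤ #Φ :=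
  csInf_le' ⟨Φ, hΦ, rfl⟩

theorem basicCard_eq_continuum {X : Type u} [TopologicalSpace X]
    [TopologicalSpace.SeparableSpace X]
    (h : ∃ F : (ℕ → Bool) → C(X, ℝ), ∀ (m : ℕ) (φ : C(X, Fin m → ℝ)),
      {α | ∃ g : C(Fin m → ℝ, ℝ), ∀ x, F α x = g (φ x)}.Countable) : basicCard X = 𝔠 := by
  obtain ⟨F, hF⟩ := h
  refine le_antisymm ?_ (le_csInf ⟨_, Set.univ, isBasicFamily_univ X, rfl⟩ ?_)
  · refine (isBasicFamily_univ X).basicCard_le.trans ?_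
    rw [mk_univ]
    exact mk_continuousMap_le_continuum X
  · rintro _ ⟨Φ, hΦ, rfl⟩
    exact continuum_le_mk_of_isBasicFamily F hF Φ hΦ

theorem stmt0 (X : Type u) [TopologicalSpace X] [TopologicalSpace.MetrizableSpace X]
    [TopologicalSpace.SeparableSpace X] :
    (LocallyCompactSpace X ∧ (∃ n, DimLE X n) ∧ basicCard X < ℵ₀) ∨
    (¬(LocallyCompactSpace X ∧ ∃ n, DimLE X n) ∧ basicCard X = 𝔠) := by
  have : SecondCountableTopology X := by
    let := TopologicalSpace.metrizableSpaceMetric X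
    exact UniformSpace.secondCountable_of_separable X
  by_cases hlc : LocallyCompactSpace X
  · by_cases hdim : ∃ n, DimLE X n
    · obtain ⟨n, hn⟩ := hdim
      obtain ⟨Φ, hfin, hΦ⟩ := hn.avoids_univ.exists_finite_isBasicFamily
      exact Or.inl ⟨hlc, ⟨n, hn⟩, hΦ.basicCard_le.trans_lt (lt_aleph0_iff_set_finite.2 hfin)⟩
    · exact Or.inr ⟨fun h => hdim h.2, basicCard_eq_continuum
        (exists_cantor_family_of_forall_not_avoids fun k hk =>
          hdim ⟨k, dimLE_of_avoids_univ (hk.mono_card k.le_succ)⟩)⟩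
  · exact Or.inr ⟨fun h => hlc h.1, basicCard_eq_continuum
      (exists_cantor_family_of_not_locallyCompactSpace X hlc)⟩

end
end

section
/- Let X be a normal topological space and let C be a closed subspace of X. Then basic(X) ≥ basic(C). -/
open Cardinal Set Topology

noncomputable section

theorem IsBasicFamily.univ {X : Type u} [TopologicalSpace X] :
    IsBasicFamily (Set.univ : Set C(X, ℝ)) := fun f =>
  ⟨1, fun _ => f, fun _ => ContinuousMap.id ℝ, fun _ => Set.mem_univ _, by simp⟩

theorem IsBasicFamily.image_restrict {X : Type u} [TopologicalSpace X] [NormalSpace X]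
    {C : Set X} (hC : IsClosed C) {Φ : Set C(X, ℝ)} (hΦ : IsBasicFamily Φ) :
    IsBasicFamily ((fun φ : C(X, ℝ) => φ.restrict C) '' Φ) := by
  intro f
  obtain ⟨F, rfl⟩ := f.exists_restrict_eq hC
  obtain ⟨m, φ, g, hφ, hF⟩ := hΦ F
  exact ⟨m, fun i => (φ i).restrict C, g, fun i => Set.mem_image_of_mem _ (hφ i),
    fun x => hF x⟩

theorem stmt1 (X : Type u) [TopologicalSpace X] [NormalSpace X]
    (C : Set X) (hC : IsClosed C) :
    basicCard C ≤ basicCard X := by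
  obtain ⟨Φ, hΦ, hcard⟩ := csInf_mem
    (s := { c | ∃ Φ : Set C(X, ℝ), IsBasicFamily Φ ∧ #Φ = c }) ⟨_, _, IsBasicFamily.univ, rfl⟩
  calc basicCard C ≤ #((fun φ : C(X, ℝ) => φ.restrict C) '' Φ) :=
        csInf_le' ⟨_, hΦ.image_restrict hC, rfl⟩
    _ ≤ #Φ := Cardinal.mk_image_le
    _ = basicCard X := hcard

end
end

section
/- Fix a natural number n ≥ 2. There is a Cantor set C contained in the unit sphere {x ∈ ℝⁿ : ‖x‖ = 1} of ℝⁿ such that for any n distinct points x_1, …, x_n of C, the vectors x_1, …, x_n are linearly independent (and hence form a basis of ℝⁿ). -/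
open Cardinal Set Topology

noncomputable section

/-- The moment curve `t ↦ (1, t, …, t ^ (n - 1))` in `ℝⁿ`. -/
def momentCurve (n : ℕ) (t : ℝ) : EuclideanSpace ℝ (Fin n) :=
  WithLp.toLp 2 fun j => t ^ (j : ℕ)

theorem continuous_momentCurve (n : ℕ) : Continuous (momentCurve n) := by
  unfold momentCurve
  fun_prop

theorem momentCurve_ne_zero {n : ℕ} (hn : 0 < n) (t : ℝ) : momentCurve n t ≠ 0 := by
  intro h
  simpa [momentCurve] using congrArg (fun v : EuclideanSpace ℝ (Fin n) => v ⟨0, hn⟩) h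

/-- Distinct points on the moment curve are linearly independent. -/
theorem linearIndependent_momentCurve {n : ℕ} {t : Fin n → ℝ} (ht : Function.Injective t) :
    LinearIndependent ℝ fun i => momentCurve n (t i) := by
  have h : LinearIndependent ℝ (Matrix.vandermonde t).row :=
    Matrix.linearIndependent_rows_of_det_ne_zero (Matrix.det_vandermonde_ne_zero_iff.2 ht)
  exact h.map' (WithLp.linearEquiv 2 ℝ (Fin n → ℝ)).symm.toLinearMap (LinearEquiv.ker _)

/-- The radial projection of the moment curve to the unit sphere. -/
def sphereMomentCurve (n : ℕ) (t : ℝ) : EuclideanSpace ℝ (Fin n) :=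
  ‖momentCurve n t‖⁻¹ • momentCurve n t

theorem continuous_sphereMomentCurve {n : ℕ} (hn : 0 < n) : Continuous (sphereMomentCurve n) :=
  ((continuous_momentCurve n).norm.inv₀ fun t => norm_ne_zero_iff.2 (momentCurve_ne_zero hn t)).smul
    (continuous_momentCurve n)

theorem norm_sphereMomentCurve {n : ℕ} (hn : 0 < n) (t : ℝ) : ‖sphereMomentCurve n t‖ = 1 :=
  norm_smul_inv_norm (𝕜 := ℝ) (momentCurve_ne_zero hn t)

theorem sphereMomentCurve_injective {n : ℕ} (hn : 2 ≤ n) :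
    Function.Injective (sphereMomentCurve n) := by
  intro s t h
  have h₀ := congrArg (fun v : EuclideanSpace ℝ (Fin n) => v ⟨0, by lia⟩) h
  have h₁ := congrArg (fun v : EuclideanSpace ℝ (Fin n) => v ⟨1, by lia⟩) h
  have ht := norm_ne_zero_iff.2 (momentCurve_ne_zero (by lia : 0 < n) t)
  simp only [sphereMomentCurve, PiLp.smul_apply, smul_eq_mul] at h₀ h₁
  simp only [momentCurve, pow_zero, pow_one, mul_one] at h₀ h₁ ht
  rw [h₀] at h₁
  exact mul_left_cancel₀ (inv_ne_zero ht) h₁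

theorem linearIndependent_sphereMomentCurve {n : ℕ} (hn : 0 < n) {t : Fin n → ℝ}
    (ht : Function.Injective t) : LinearIndependent ℝ fun i => sphereMomentCurve n (t i) :=
  (linearIndependent_momentCurve ht).units_smul fun i =>
    Units.mk0 ‖momentCurve n (t i)‖⁻¹
      (inv_ne_zero (norm_ne_zero_iff.2 (momentCurve_ne_zero hn (t i))))

/-- The image of a Cantor set under a continuous injection into a Hausdorff space is a Cantor
set. -/
theorem IsCantorSet.image {X : Type u} {Y : Type v} [TopologicalSpace X] [TopologicalSpace Y]
    [T2Space Y] {C : Set X} (hC : IsCantorSet C) {f : X → Y} (hf : Continuous f)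
    (hinj : Function.Injective f) : IsCantorSet (f '' C) := by
  obtain ⟨e⟩ := hC
  have : CompactSpace C := e.symm.compactSpace
  have hemb := (hf.comp continuous_subtype_val).isClosedEmbedding
    (hinj.comp (Subtype.val_injective (p := (· ∈ C))))
  have hrange : range (f ∘ ((↑) : C → X)) = f '' C := by
    rw [range_comp, Subtype.range_coe]
  exact ⟨(Homeomorph.setCongr hrange).symm.trans (hemb.isEmbedding.toHomeomorph.symm.trans e)⟩

theorem stmt3 (n : ℕ) (hn : 2 ≤ n) :
    ∃ C : Set (EuclideanSpace ℝ (Fin n)),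
      C ⊆ Metric.sphere (0 : EuclideanSpace ℝ (Fin n)) 1 ∧ IsCantorSet C ∧
      ∀ x : Fin n → EuclideanSpace ℝ (Fin n),
        (∀ i, x i ∈ C) → Function.Injective x → LinearIndependent ℝ x := by
  refine ⟨sphereMomentCurve n '' cantorSet, ?_,
    IsCantorSet.image ⟨cantorSetHomeomorphNatToBool⟩ (continuous_sphereMomentCurve (by lia))
      (sphereMomentCurve_injective hn), ?_⟩
  · rintro _ ⟨t, -, rfl⟩
    exact mem_sphere_zero_iff_norm.2 (norm_sphereMomentCurve (by lia) t)
  · intro x hx hinj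
    choose t _ ht using hx
    obtain rfl : (fun i => sphereMomentCurve n (t i)) = x := funext ht
    exact linearIndependent_sphereMomentCurve (by lia)
      (Function.Injective.of_comp (f := sphereMomentCurve n) hinj)

end
end

section
/- Fix a natural number n ≥ 2, let J be a non-trivial closed bounded interval of ℝ, and let B be a topological space homeomorphic to the n-cube Jⁿ. Then there is a Cantor set D contained in C(B,J), the space of continuous maps from B to J with the topology of uniform convergence, such that for any n distinct elements d_1, …, d_n of D, the map d = (d_1, …, d_n) : B → Jⁿ is a topological embedding. -/
open Cardinal Set Topology

noncomputable section

/-- The affine function with coefficients `1, t, t², …`, normalized so as to map the cube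
`[a, b]ⁿ` to `[a, b]` for `t ∈ [0, 1]`. -/
def momentFun {n : ℕ} (a t : ℝ) (x : Fin n → ℝ) : ℝ :=
  a + (∑ i : Fin n, t ^ (i : ℕ) * (x i - a)) / n

lemma continuous_momentFun {n : ℕ} (a : ℝ) :
    Continuous fun p : ℝ × (Fin n → ℝ) => momentFun a p.1 p.2 := by
  unfold momentFun
  fun_prop

lemma momentFun_mem_Icc {n : ℕ} (hn : n ≠ 0) {a b t : ℝ} (ht : t ∈ Icc (0 : ℝ) 1)
    {x : Fin n → ℝ} (hx : ∀ i, x i ∈ Icc a b) : momentFun a t x ∈ Icc a b := by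
  have hn' : (0 : ℝ) < n := by positivity
  have hnonneg : 0 ≤ ∑ i : Fin n, t ^ (i : ℕ) * (x i - a) :=
    Finset.sum_nonneg fun i _ => mul_nonneg (pow_nonneg ht.1 _) (sub_nonneg.2 (hx i).1)
  have hle : ∑ i : Fin n, t ^ (i : ℕ) * (x i - a) ≤ n * (b - a) := by
    calc ∑ i : Fin n, t ^ (i : ℕ) * (x i - a) ≤ ∑ _i : Fin n, (b - a) :=
          Finset.sum_le_sum fun i _ =>
            (mul_le_of_le_one_left (sub_nonneg.2 (hx i).1) (pow_le_one₀ ht.1 ht.2)).trans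
              (sub_le_sub_right (hx i).2 a)
      _ = n * (b - a) := by simp [mul_sub]
  have hdiv : (∑ i : Fin n, t ^ (i : ℕ) * (x i - a)) / n ≤ b - a := by
    rwa [div_le_iff₀' hn']
  exact ⟨le_add_of_nonneg_right (div_nonneg hnonneg hn'.le), by unfold momentFun; linarith⟩

/-- The moment functions at `n` distinct parameters separate points, by invertibility of the
Vandermonde matrix. -/
lemma eq_of_forall_momentFun_eq {n : ℕ} {a : ℝ} {t : Fin n → ℝ} (ht : Function.Injective t)
    {x y : Fin n → ℝ} (h : ∀ j, momentFun a (t j) x = momentFun a (t j) y) : x = y := by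
  refine sub_eq_zero.1 (Matrix.eq_zero_of_forall_index_sum_pow_mul_eq_zero ht fun j => ?_)
  have hn : (n : ℝ) ≠ 0 := Nat.cast_ne_zero.2 j.pos.ne'
  have hj := (div_left_inj' hn).1 (add_left_cancel (h j))
  rw [← sub_eq_zero, ← Finset.sum_sub_distrib] at hj
  rw [← hj]
  refine Finset.sum_congr rfl fun i _ => ?_
  simp only [Pi.sub_apply]
  ring

lemma momentFun_update {n : ℕ} (a b t : ℝ) (k : Fin n) :
    momentFun a t (Function.update (fun _ => a) k b) = a + t ^ (k : ℕ) * (b - a) / n := by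
  unfold momentFun
  rw [Finset.sum_eq_single k] <;> simp +contextual [Function.update_of_ne]

theorem stmt4 (n : ℕ) (hn : 2 ≤ n) (a b : ℝ) (hab : a < b)
    (B : Type) [TopologicalSpace B] (e : B ≃ₜ (Fin n → ↥(Set.Icc a b))) :
    ∃ D : Set C(B, ↥(Set.Icc a b)), IsCantorSet D ∧
      ∀ d : Fin n → C(B, ↥(Set.Icc a b)), (∀ i, d i ∈ D) → Function.Injective d →
        IsEmbedding (fun x : B => fun i : Fin n => d i x) := by
  have : CompactSpace B := e.symm.compactSpace
  have : T2Space B := e.symm.t2Space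
  have hn0 : n ≠ 0 := by omega
  let τ : (ℕ → Bool) → ℝ := fun s => cantorSetHomeomorphNatToBool.symm s
  have hτc : Continuous τ :=
    continuous_subtype_val.comp cantorSetHomeomorphNatToBool.symm.continuous
  have hτi : Function.Injective τ :=
    Subtype.val_injective.comp cantorSetHomeomorphNatToBool.symm.injective
  have hτm (s) : τ s ∈ Icc (0 : ℝ) 1 :=
    cantorSet_subset_unitInterval (cantorSetHomeomorphNatToBool.symm s).2
  let F : C((ℕ → Bool) × B, Icc a b) :=
    { toFun := fun p => ⟨momentFun a (τ p.1) fun i => e p.2 i,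
        momentFun_mem_Icc hn0 (hτm p.1) fun i => (e p.2 i).2⟩
      continuous_toFun := Continuous.subtype_mk
        ((continuous_momentFun a).comp (f := fun p : (ℕ → Bool) × B =>
          (τ p.1, fun i => (e p.2 i : ℝ))) (by fun_prop)) _ }
  have hF (s x) : (F.curry s x : ℝ) = momentFun a (τ s) fun i => e x i := rfl
  have hinj : Function.Injective F.curry := by
    intro s s' h
    let k : Fin n := ⟨1, hn⟩
    let v : Fin n → Icc a b :=
      Function.update (fun _ => ⟨a, left_mem_Icc.2 hab.le⟩) k ⟨b, right_mem_Icc.2 hab.le⟩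
    have hv : (fun i => (v i : ℝ)) = Function.update (fun _ => a) k b := by
      funext i
      by_cases hi : i = k
      · subst hi; simp [v]
      · simp [v, hi]
    have h' : (F.curry s (e.symm v) : ℝ) = F.curry s' (e.symm v) := by rw [h]
    simp only [hF, e.apply_symm_apply, hv, momentFun_update] at h'
    have hba : b - a ≠ 0 := (sub_pos.2 hab).ne'
    have hnr : (n : ℝ) ≠ 0 := Nat.cast_ne_zero.2 hn0
    have h'' := mul_right_cancel₀ hba ((div_left_inj' hnr).1 (add_left_cancel h'))
    exact hτi (by simpa [k] using h'')
  have hemb : IsEmbedding F.curry := (F.curry.continuous.isClosedEmbedding hinj).isEmbedding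
  refine ⟨range F.curry, ⟨hemb.toHomeomorph.symm⟩, fun d hd hdi => ?_⟩
  choose s hs using hd
  have hsi : Function.Injective s := fun i j hij => hdi (by rw [← hs i, ← hs j, hij])
  refine (Continuous.isClosedEmbedding (by fun_prop) fun x y hxy => ?_).isEmbedding
  have hval := eq_of_forall_momentFun_eq (a := a) (hτi.comp hsi)
    (x := fun i => (e x i : ℝ)) (y := fun i => (e y i : ℝ)) fun j => by
      have hj : d j x = d j y := congrFun hxy j
      rw [← hs j] at hj
      exact congrArg Subtype.val hj
  exact e.injective (funext fun i => Subtype.ext (congrFun hval i))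

end
end

section
/- Fix n ≥ 2 and let K be a compact Hausdorff space with dim K > n (i.e., it is not the case that dim K ≤ n). Then there is a Cantor set C contained in C(K,[0,1]) (with the topology of uniform convergence) such that for every continuous map φ : K → [0,1]ⁿ, the set C ∩ {g ∘ φ : g ∈ C([0,1]ⁿ,[0,1])} has at most n elements. -/
open Cardinal Set Topology

noncomputable section

/-- A continuous map into a normed space of larger dimension can be made nowhere zero by changing
it only where its norm is less than `1`. -/
theorem Continuous.exists_ne_zero_eqOn_one_le_norm {E F : Type*}
    [NormedAddCommGroup E] [NormedSpace ℝ E] [FiniteDimensional ℝ E]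
    [NormedAddCommGroup F] [NormedSpace ℝ F] [FiniteDimensional ℝ F]
    (hEF : Module.finrank ℝ E < Module.finrank ℝ F) {f : E → F} (hf : Continuous f) :
    ∃ h : E → F, Continuous h ∧ (∀ x, h x ≠ 0) ∧ ∀ x, 1 ≤ ‖f x‖ → h x = f x := by
  obtain ⟨g, hg, hgf, -⟩ := hf.exists_contDiff_approx 1 (ε := fun _ => 1 / 4)
    continuous_const (fun _ => by norm_num)
  have hdense := ContDiff.dense_compl_range_of_finrank_lt_finrank hg hEF
  obtain ⟨p, hp, hp0⟩ := hdense.exists_dist_lt (0 : F) (ε := 1 / 4) (by norm_num)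
  have hp_norm : ‖p‖ < 1 / 4 := by simpa using hp0
  let s : E → ℝ := fun x => max 0 (min 1 (2 * ‖f x‖ - 1))
  have hs0 x : 0 ≤ s x := le_max_left _ _
  have hs1 x : s x ≤ 1 := max_le zero_le_one (min_le_left _ _)
  have hs : Continuous s := by fun_prop
  refine ⟨fun x => f x + (1 - s x) • (g x - p - f x), ?_, fun x hx => ?_, fun x hx => ?_⟩
  · have := hg.continuous
    fun_prop
  · dsimp only at hx
    rcases le_or_gt ‖f x‖ (1 / 2) with hle | hlt
    · have hsx : s x = 0 := max_eq_left ((min_le_right _ _).trans (by linarith))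
      rw [hsx, sub_zero, one_smul, add_sub_cancel, sub_eq_zero] at hx
      exact hp ⟨x, hx⟩
    · have hclose : ‖g x - p - f x‖ < 1 / 2 := by
        have h₁ : ‖g x - f x‖ < 1 / 4 := by
          simpa [dist_eq_norm] using hgf x
        have h₂ : g x - p - f x = (g x - f x) - p := by abel
        rw [h₂]
        exact (norm_sub_le _ _).trans_lt (by linarith)
      have hbound : ‖(1 - s x) • (g x - p - f x)‖ ≤ ‖g x - p - f x‖ := by
        rw [norm_smul, Real.norm_of_nonneg (by linarith [hs1 x])]
        exact mul_le_of_le_one_left (norm_nonneg _) (by linarith [hs0 x])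
      rw [eq_neg_of_add_eq_zero_left hx, norm_neg] at hlt
      linarith
  · have hsx : s x = 1 := by
      simp only [s]
      rw [min_eq_left (by linarith), max_eq_right zero_le_one]
    simp [hsx]

/-- If a map from a closed set into the `n`-sphere does not extend over the whole space, then no
extension of it to a map into `ℝⁿ⁺¹` factors through `ℝⁿ`. -/
theorem not_factors_of_not_extends {K : Type*} [TopologicalSpace K] {n : ℕ} {A : Set K}
    {f : C(A, Metric.sphere (0 : EuclideanSpace ℝ (Fin (n + 1))) 1)}
    (hf : ¬ ∃ F : C(K, Metric.sphere (0 : EuclideanSpace ℝ (Fin (n + 1))) 1), ∀ a : A, F a = f a)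
    {F : K → EuclideanSpace ℝ (Fin (n + 1))} (hF : ∀ a : A, F a = f a)
    {φ : K → Fin n → ℝ} (hφ : Continuous φ)
    {g : (Fin n → ℝ) → EuclideanSpace ℝ (Fin (n + 1))} (hg : Continuous g) :
    ¬ ∀ x, F x = g (φ x) := by
  intro hfac
  obtain ⟨h, hh, hh0, hhg⟩ := hg.exists_ne_zero_eqOn_one_le_norm (by simp)
  refine hf ⟨⟨fun x => ⟨‖h (φ x)‖⁻¹ • h (φ x), ?_⟩, ?_⟩, fun a => ?_⟩
  · simp [norm_smul, hh0]
  · refine Continuous.subtype_mk ?_ _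
    exact ((hh.comp hφ).norm.inv₀ fun x => norm_ne_zero_iff.2 (hh0 _)).smul (hh.comp hφ)
  · have hga : g (φ a) = f a := by rw [← hfac, hF]
    have hnorm : ‖g (φ a)‖ = 1 := by rw [hga]; exact norm_eq_of_mem_sphere _
    apply Subtype.ext
    simp [hhg _ hnorm.ge, hga]

/-- On a compact space, a continuous real function can be moved into the unit interval
by an affine change of variables. -/
theorem ContinuousMap.exists_affine_unitInterval {X : Type*} [TopologicalSpace X] [CompactSpace X]
    (f : C(X, ℝ)) : ∃ (c : ℝ) (u : C(X, Set.Icc (0 : ℝ) 1)),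
      ∀ x, f x = c * ((u x : ℝ) - 1 / 2) := by
  have hc : (0 : ℝ) < 2 * (‖f‖ + 1) := by positivity
  have hmem (x : X) : f x / (2 * (‖f‖ + 1)) + 1 / 2 ∈ Set.Icc (0 : ℝ) 1 := by
    have h := abs_le.1 (f.norm_coe_le_norm x)
    have h₁ : -(1 / 2) ≤ f x / (2 * (‖f‖ + 1)) := by
      rw [le_div_iff₀ hc]; linarith [h.1]
    have h₂ : f x / (2 * (‖f‖ + 1)) ≤ 1 / 2 := by
      rw [div_le_iff₀ hc]; linarith [h.2]
    constructor <;> linarith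
  refine ⟨2 * (‖f‖ + 1), ⟨fun x => ⟨_, hmem x⟩, Continuous.subtype_mk (by fun_prop) hmem⟩,
    fun x => ?_⟩
  simp only [ContinuousMap.coe_mk]
  field_simp
  ring

theorem stmt5 (n : ℕ) (hn : 2 ≤ n) (K : Type) [TopologicalSpace K]
    [CompactSpace K] [T2Space K] (hdim : ¬ DimLE K n) :
    ∃ C : Set C(K, ↥(Set.Icc (0:ℝ) 1)), IsCantorSet C ∧
      ∀ φ : C(K, Fin n → ↥(Set.Icc (0:ℝ) 1)),
        #(C ∩ { f : C(K, ↥(Set.Icc (0:ℝ) 1)) |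
            ∃ g : C((Fin n → ↥(Set.Icc (0:ℝ) 1)), ↥(Set.Icc (0:ℝ) 1)),
              ∀ x, f x = g (φ x) } : Set C(K, ↥(Set.Icc (0:ℝ) 1))) ≤ n := by
  simp only [DimLE, not_forall] at hdim
  obtain ⟨A, hA, f, hf⟩ := hdim
  obtain ⟨F, hF⟩ := ContinuousMap.exists_restrict_eq (Y := EuclideanSpace ℝ (Fin (n + 1))) hA
    (⟨fun a => f a, by fun_prop⟩ : C(A, EuclideanSpace ℝ (Fin (n + 1))))
  replace hF (a : A) : F a = f a := DFunLike.congr_fun hF a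
  have : CompactSpace cantorSet := isCompact_iff_compactSpace.1 isCompact_cantorSet
  obtain ⟨c, v, hv⟩ := ContinuousMap.exists_affine_unitInterval
    (⟨fun p => ∑ i : Fin (n + 1), (p.1 : ℝ) ^ (i : ℕ) * F p.2 i, by fun_prop⟩ : C(cantorSet × K, ℝ))
  let u : C(cantorSet, C(K, Set.Icc (0 : ℝ) 1)) := v.curry
  have hu (t : cantorSet) (x : K) :
      ∑ i : Fin (n + 1), (t : ℝ) ^ (i : ℕ) * F x i = c * ((u t x : ℝ) - 1 / 2) := hv (t, x)
  have key (t : Fin (n + 1) → cantorSet) (ht : t.Injective)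
      (φ : C(K, Fin n → Set.Icc (0 : ℝ) 1)) :
      ¬ ∀ j, ∃ g : C(Fin n → Set.Icc (0 : ℝ) 1, Set.Icc (0 : ℝ) 1), ∀ x, u (t j) x = g (φ x) := by
    intro hfac
    choose g hg using hfac
    let V : Matrix (Fin (n + 1)) (Fin (n + 1)) ℝ := Matrix.vandermonde fun j => (t j : ℝ)
    have hV : IsUnit V.det := isUnit_iff_ne_zero.2
      (Matrix.det_vandermonde_ne_zero_iff.2 (Subtype.val_injective.comp ht))
    let r : (Fin n → ℝ) → Fin n → Set.Icc (0 : ℝ) 1 :=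
      fun y i => Set.projIcc 0 1 zero_le_one (y i)
    have hr : Continuous r := by
      refine continuous_pi fun i => ?_
      exact continuous_projIcc.comp (continuous_apply i)
    refine not_factors_of_not_extends hf hF (φ := fun x i => (φ x i : ℝ)) (by fun_prop)
      (g := fun y => WithLp.toLp 2 (V⁻¹.mulVec fun j => c * ((g j (r y) : ℝ) - 1 / 2)))
      (by fun_prop) fun x => ?_
    have hrx : r (fun i => (φ x i : ℝ)) = φ x := by
      funext i
      exact Set.projIcc_val _ _
    have hVF : V.mulVec (F x).ofLp = fun j => c * ((g j (φ x) : ℝ) - 1 / 2) := by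
      funext j
      rw [← hg j x, ← hu]
      rfl
    simp only [hrx, ← hVF, Matrix.mulVec_mulVec, Matrix.nonsing_inv_mul V hV, Matrix.one_mulVec]
  have : Infinite cantorSet := cantorSetHomeomorphNatToBool.toEquiv.infinite_iff.2 inferInstance
  have hu_inj : Function.Injective u := by
    intro a b hab
    by_contra hne
    obtain ⟨s, hsub, hcard⟩ := Infinite.exists_superset_card_eq ({a, b} : Finset cantorSet) (n + 1)
      (Finset.card_le_two.trans (by omega))
    have hcard' : (s.erase a).card = n := by
      rw [Finset.card_erase_of_mem (hsub (by simp)), hcard]; rfl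
    let e := s.equivFinOfCardEq hcard
    let e' := (s.erase a).equivFinOfCardEq hcard'
    let φ : C(K, Fin n → Set.Icc (0 : ℝ) 1) :=
      ⟨fun x i => u (e'.symm i) x, by fun_prop⟩
    have hmem (d : cantorSet) (hd : d ∈ s.erase a) :
        ∃ g : C(Fin n → Set.Icc (0 : ℝ) 1, Set.Icc (0 : ℝ) 1), ∀ x, u d x = g (φ x) :=
      ⟨⟨fun y => y (e' ⟨d, hd⟩), by fun_prop⟩, fun x => by simp [φ]⟩
    refine key (fun j => e.symm j) (Subtype.val_injective.comp e.symm.injective) φ fun j => ?_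
    by_cases hj : (e.symm j : cantorSet) = a
    · rw [hj, hab]
      exact hmem b (Finset.mem_erase.2 ⟨Ne.symm hne, hsub (by simp)⟩)
    · exact hmem _ (Finset.mem_erase.2 ⟨hj, (e.symm j).2⟩)
  refine ⟨Set.range u, ⟨?_⟩, fun φ => ?_⟩
  · exact (u.continuous.isClosedEmbedding hu_inj).isEmbedding.toHomeomorph.symm.trans
      cantorSetHomeomorphNatToBool
  · by_contra! hlt
    have hle := Order.succ_le_of_lt hlt
    rw [Cardinal.succ_natCast, ← Nat.cast_succ, ← Cardinal.mk_fin] at hle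
    obtain ⟨w⟩ := hle
    choose t ht using fun j => (w j).2.1
    refine key t (fun i j hij => w.injective (Subtype.ext ?_)) φ fun j => ?_
    · rw [← ht, ← ht, hij]
    · rw [ht]
      exact (w j).2.2

end
end

section
/- Let (C_n)_{n∈ℕ} be a sequence of compact Hausdorff spaces such that each C_n is finite dimensional with dim C_n > n. Let X = ⊕_n C_n be their topological disjoint sum, and let γX be any compactification of X (a compact Hausdorff space containing X as a dense subspace). Then there is a Cantor set C contained in C(γX,[0,1]) whose family of restrictions to X is strongly independent in C(X). Consequently basic(X) ≥ 𝔠 and basic(γX) ≥ 𝔠, where 𝔠 = 2^ℵ0. -/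
open Cardinal Set Topology

noncomputable section

/-- A finite family of real functions, seen as a map into a cube, is stable if some value
is attained by every sufficiently small uniform perturbation of it. -/
def IsStableFamily {Y κ : Type*} [TopologicalSpace Y] (F : κ → C(Y, ℝ)) : Prop :=
  ∃ (c : κ → ℝ) (ε : ℝ), 0 < ε ∧ ∀ H : κ → C(Y, ℝ),
    (∀ i y, |H i y - F i y| < ε) → ∃ y, ∀ i, H i y = c i

namespace IsStableFamily

theorem comp_injective {Y κ κ' : Type*} [TopologicalSpace Y] {F : κ → C(Y, ℝ)}
    (hF : IsStableFamily F) {j : κ' → κ} (hj : Function.Injective j) :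
    IsStableFamily (F ∘ j) := by
  obtain ⟨c, ε, hε, h⟩ := hF
  refine ⟨c ∘ j, ε, hε, fun H hH => ?_⟩
  obtain ⟨y, hy⟩ := h (Function.extend j H F) fun i y => by
    by_cases hi : ∃ a, j a = i
    · obtain ⟨a, rfl⟩ := hi
      rw [hj.extend_apply]
      exact hH a y
    · rw [Function.extend_apply' _ _ _ hi]
      simpa using hε
  exact ⟨y, fun a => by simpa [hj.extend_apply] using hy (j a)⟩

theorem affine {Y κ : Type*} [TopologicalSpace Y] {F G : κ → C(Y, ℝ)}
    (hF : IsStableFamily F) {a b : ℝ} (ha : 0 < a) (hG : ∀ i y, G i y = a * F i y + b) :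
    IsStableFamily G := by
  obtain ⟨c, ε, hε, h⟩ := hF
  refine ⟨fun i => a * c i + b, a * ε, by positivity, fun H hH => ?_⟩
  obtain ⟨y, hy⟩ := h (fun i => ⟨fun y => a⁻¹ * (H i y - b), by fun_prop⟩) fun i y => by
    have h1 := hH i y
    have h2 : H i y - G i y = a * (a⁻¹ * (H i y - b) - F i y) := by
      rw [hG]; field_simp; ring
    rw [h2, abs_mul, abs_of_pos ha] at h1
    exact lt_of_mul_lt_mul_left h1 ha.le
  refine ⟨y, fun i => ?_⟩
  have := hy i
  simp only [ContinuousMap.coe_mk] at this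
  simp only [← this]
  field_simp
  ring

/-- A stable family of `n + 1` functions does not factor through an `n`-dimensional space. -/
theorem not_factors {Y : Type*} [TopologicalSpace Y] {n : ℕ} {F : Fin (n + 1) → C(Y, ℝ)}
    (hF : IsStableFamily F) (φ : C(Y, Fin n → ℝ)) (g : Fin (n + 1) → C((Fin n → ℝ), ℝ)) :
    ¬ ∀ i y, F i y = g i (φ y) := by
  intro hg
  obtain ⟨c, ε, hε, h⟩ := hF
  have hG : Continuous fun x : Fin n → ℝ => fun i => g i x := by fun_prop
  obtain ⟨P, hP, hPG, -⟩ := hG.exists_contDiff_approx 1 (ε := fun _ => ε / 2)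
    continuous_const (fun _ => by positivity)
  have hd : Dense (range P)ᶜ := hP.dense_compl_range_of_finrank_lt_finrank (by simp)
  obtain ⟨d, hd, hdc⟩ := hd.exists_dist_lt c (half_pos hε)
  have hPc := hP.continuous
  obtain ⟨y, hy⟩ := h (fun i => ⟨fun y => P (φ y) i - d i + c i, by fun_prop⟩) fun i y => by
    have h1 := (dist_le_pi_dist _ _ i).trans_lt (hPG (φ y))
    have h2 := (dist_le_pi_dist _ _ i).trans_lt hdc
    rw [Real.dist_eq] at h1 h2
    simp only [ContinuousMap.coe_mk, hg]
    rw [abs_lt] at *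
    constructor <;> linarith
  refine hd ⟨φ y, funext fun i => ?_⟩
  have := hy i
  simp only [ContinuousMap.coe_mk] at this
  linarith

end IsStableFamily

/-- If a sphere-valued map `f` on a subset extends to a map `F` into the ambient normed space
that is uniformly close to a nowhere vanishing map, then `f` extends to a sphere-valued map. -/
theorem exists_sphere_extension {Y E : Type*} [TopologicalSpace Y] [NormedAddCommGroup E]
    [NormedSpace ℝ E] {A : Set Y} (f : C(A, Metric.sphere (0 : E) 1)) (F H : C(Y, E))
    (hF : ∀ a : A, F a = f a) (hH : ∀ y, H y ≠ 0) (hFH : ∀ y, ‖H y - F y‖ < 1 / 2) :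
    ∃ G : C(Y, Metric.sphere (0 : E) 1), ∀ a : A, G a = f a := by
  let u : Y → ℝ := fun y => max 0 (min 1 (2 * ‖F y‖ - 1))
  have hu : Continuous u := by fun_prop
  let V : Y → E := fun y => F y + (1 - u y) • (H y - F y)
  have hV : Continuous V := by fun_prop
  have hV0 : ∀ y, V y ≠ 0 := by
    intro y
    by_cases hy : ‖F y‖ ≤ 1 / 2
    · have : u y = 0 := max_eq_left ((min_le_right _ _).trans (by linarith))
      simpa [V, this] using hH y
    · intro h0
      have hu0 : 0 ≤ u y := le_max_left _ _
      have hu1 : u y ≤ 1 := max_le zero_le_one (min_le_left _ _)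
      have h1 : ‖F y‖ = ‖(1 - u y) • (H y - F y)‖ := by
        simpa only [norm_neg] using congrArg norm (eq_neg_of_add_eq_zero_left h0)
      rw [norm_smul, Real.norm_of_nonneg (by linarith)] at h1
      have := hFH y
      have := norm_nonneg (H y - F y)
      nlinarith
  refine ⟨⟨fun y => ⟨‖V y‖⁻¹ • V y, ?_⟩, ?_⟩, fun a => ?_⟩
  · rw [mem_sphere_zero_iff_norm, norm_smul, norm_inv, norm_norm,
      inv_mul_cancel₀ (norm_ne_zero_iff.2 (hV0 y))]
  · exact ((hV.norm.inv₀ fun y => norm_ne_zero_iff.2 (hV0 y)).smul hV).subtype_mk _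
  · have hn : ‖F a‖ = 1 := by rw [hF]; exact mem_sphere_zero_iff_norm.1 (f a).2
    have hu1 : u a = 1 := by simp only [u, hn]; norm_num
    have hVa : V a = F a := by simp [V, hu1]
    apply Subtype.ext
    simp [hVa, hF]

/-- A compact Hausdorff space which is not at most `n`-dimensional carries a stable family of
`n + 1` functions with values in the unit interval. -/
theorem exists_isStableFamily {Y : Type*} [TopologicalSpace Y] [CompactSpace Y] [T2Space Y]
    {n : ℕ} (hY : ¬ DimLE Y n) :
    ∃ F : Fin (n + 1) → C(Y, ℝ), IsStableFamily F ∧ ∀ i y, F i y ∈ Icc (0 : ℝ) 1 := by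
  unfold DimLE at hY
  push Not at hY
  obtain ⟨A, hA, f, hf⟩ := hY
  obtain ⟨F₀, hF₀⟩ := ContinuousMap.exists_restrict_eq hA
    (⟨fun a => WithLp.ofLp (f a : EuclideanSpace ℝ (Fin (n + 1))), by fun_prop⟩ :
      C(A, Fin (n + 1) → ℝ))
  have hF₀A : ∀ a : A, F₀ a = WithLp.ofLp (f a : EuclideanSpace ℝ (Fin (n + 1))) :=
    fun a => DFunLike.congr_fun hF₀ a
  let F : Fin (n + 1) → C(Y, ℝ) := fun i => ⟨fun y => F₀ y i, by fun_prop⟩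
  have hstable : IsStableFamily F := by
    have hL : UniformContinuous (WithLp.toLp 2 : (Fin (n + 1) → ℝ) → _) :=
      (PiLp.lipschitzWith_toLp 2 (fun _ : Fin (n + 1) => ℝ)).uniformContinuous
    obtain ⟨ε, hε, hL⟩ := Metric.uniformContinuous_iff.1 hL (1 / 2) (by norm_num)
    refine ⟨0, ε, hε, fun H hH => ?_⟩
    by_contra! hne
    obtain ⟨G, hG⟩ := exists_sphere_extension f
      ⟨fun y => WithLp.toLp 2 (F₀ y), by fun_prop⟩
      ⟨fun y => WithLp.toLp 2 fun i => H i y, by fun_prop⟩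
      (fun a => by simp [hF₀A])
      (fun y h0 => by
        obtain ⟨i, hi⟩ := hne y
        exact hi (congrFun (congrArg WithLp.ofLp h0) i))
      (fun y => by
        rw [← dist_eq_norm]
        refine hL ((dist_pi_lt_iff hε).2 fun i => ?_)
        exact hH i y)
    obtain ⟨a, ha⟩ := hf G
    exact ha (hG a)
  obtain ⟨R, hR⟩ : ∃ R : ℝ, ∀ i y, |F i y| ≤ R := by
    obtain ⟨R, hR⟩ := (isCompact_range F₀.continuous).isBounded.exists_norm_le
    exact ⟨R, fun i y => (norm_le_pi_norm (F₀ y) i).trans (hR _ (mem_range_self y))⟩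
  have hR' : ∀ i y, |F i y| ≤ max R 1 := fun i y => (hR i y).trans (le_max_left _ _)
  have hpos : 0 < max R 1 := lt_max_of_lt_right one_pos
  set S := max R 1
  refine ⟨fun i => ⟨fun y => (2 * S)⁻¹ * F i y + 1 / 2, by fun_prop⟩,
    hstable.affine (inv_pos.2 (by positivity)) (fun i y => rfl), fun i y => ?_⟩
  have h := abs_le.1 (hR' i y)
  have e : (2 * S)⁻¹ * F i y + 1 / 2 = (F i y + S) / (2 * S) := by field_simp
  simp only [ContinuousMap.coe_mk, e]
  exact ⟨div_nonneg (by linarith) (by positivity), (div_le_one (by positivity)).2 (by linarith)⟩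

/-- There are continuous maps from the Cantor space to finite discrete spaces of size
`m + 1` that eventually separate any two given points. -/
theorem exists_eventually_separating :
    ∃ e : ∀ m : ℕ, (ℕ → Bool) → Fin (m + 1), (∀ m, Continuous (e m)) ∧
      ∀ s t, s ≠ t → ∀ᶠ m in Filter.atTop, e m s ≠ e m t := by
  have key : ∀ m : ℕ, Nonempty ((Fin (Nat.log 2 (m + 1)) → Bool) ↪ Fin (m + 1)) := fun m =>
    Function.Embedding.nonempty_of_card_le (by simpa using Nat.pow_log_le_self 2 m.succ_ne_zero)
  let j := fun m => (key m).some
  refine ⟨fun m s => j m fun i => s i, fun m => ?_, fun s t hst => ?_⟩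
  · exact (continuous_of_discreteTopology (f := j m)).comp (by fun_prop)
  · obtain ⟨i, hi⟩ := Function.ne_iff.1 hst
    filter_upwards [Filter.eventually_ge_atTop (2 ^ (i + 1))] with m hm h
    have hlt : i < Nat.log 2 (m + 1) :=
      Nat.lt_of_succ_le (Nat.le_log_of_pow_le one_lt_two (by omega))
    exact hi (congrFun ((j m).injective h) ⟨i, hlt⟩)

/-- The summands of a disjoint sum of compact spaces are clopen in every compactification. -/
theorem isOpenEmbedding_comp_sigmaMk {κ γ : Type*} {C' : κ → Type*} [∀ n, TopologicalSpace (C' n)]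
    [∀ n, CompactSpace (C' n)] [TopologicalSpace γ] [T2Space γ] {ι : (Σ n, C' n) → γ}
    (hι : IsEmbedding ι) (hdense : DenseRange ι) (m : κ) :
    IsOpenEmbedding (fun x : C' m => ι ⟨m, x⟩) := by
  have hemb : IsEmbedding (fun x : C' m => ι ⟨m, x⟩) := hι.comp .sigmaMk
  refine ⟨hemb, ?_⟩
  obtain ⟨O, hO, hOι⟩ := hι.isOpen_iff.1 (isOpen_range_sigmaMk (σ := C') (i := m))
  have hclosed : IsClosed (range fun x : C' m => ι ⟨m, x⟩) :=
    (isCompact_range hemb.continuous).isClosed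
  suffices (range fun x : C' m => ι ⟨m, x⟩) = O from this ▸ hO
  apply Subset.antisymm
  · rintro _ ⟨x, rfl⟩
    exact hOι.ge ⟨x, rfl⟩
  · refine (hdense.open_subset_closure_inter hO).trans (hclosed.closure_subset_iff.2 ?_)
    rintro _ ⟨hy, p, rfl⟩
    obtain ⟨x, rfl⟩ := hOι.le hy
    exact ⟨x, rfl⟩

/-- Functions on the summands depending continuously on a parameter, with sup norms decaying along
the summands, glue to a jointly continuous function on the compactification. -/
theorem continuous_extend_sigma {P γ : Type*} {C' : ℕ → Type*} [TopologicalSpace P]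
    [∀ n, TopologicalSpace (C' n)] [∀ n, CompactSpace (C' n)] [TopologicalSpace γ] [T2Space γ]
    {ι : (Σ n, C' n) → γ} (hι : IsEmbedding ι) (hdense : DenseRange ι)
    (q : P → (Σ n, C' n) → ℝ) (hq : ∀ m, Continuous fun p : P × C' m => q p.1 ⟨m, p.2⟩)
    (hbound : ∀ s p, |q s p| ≤ 1 / ((p.1 : ℝ) + 1)) :
    Continuous fun p : P × γ => Function.extend ι (q p.1) 0 p.2 := by
  have hopen := isOpenEmbedding_comp_sigmaMk hι hdense
  rw [continuous_iff_continuousAt]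
  rintro ⟨s, y⟩
  by_cases hy : ∃ p, ι p = y
  · obtain ⟨⟨m, x⟩, rfl⟩ := hy
    have hj := (IsOpenEmbedding.id (X := P)).prodMap (hopen m)
    refine (hj.continuousAt_iff (x := (s, x))).1 ?_
    convert (hq m).continuousAt using 1
    funext p
    exact hι.injective.extend_apply _ _ _
  · rw [ContinuousAt, Function.extend_apply' _ _ _ hy, Pi.zero_apply, Metric.tendsto_nhds]
    intro ε hε
    obtain ⟨N, hN⟩ := exists_nat_one_div_lt hε
    have hev : ∀ᶠ p : P × γ in 𝓝 (s, y),
        ∀ m ∈ Finset.range N, p.2 ∉ range fun x : C' m => ι ⟨m, x⟩ := by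
      rw [Filter.eventually_all_finset]
      intro m _
      have hc : IsClosed (range fun x : C' m => ι ⟨m, x⟩) :=
        (isCompact_range (hopen m).continuous).isClosed
      refine continuous_snd.continuousAt.eventually (hc.isOpen_compl.mem_nhds ?_)
      rintro ⟨x, hx⟩
      exact hy ⟨_, hx⟩
    filter_upwards [hev] with p hp
    rw [Real.dist_eq, sub_zero]
    by_cases hpy : ∃ a, ι a = p.2
    · obtain ⟨⟨m, x⟩, hx⟩ := hpy
      rw [← hx, hι.injective.extend_apply]
      have hm : N ≤ m := by
        by_contra! hlt
        exact hp m (Finset.mem_range.2 hlt) ⟨x, hx⟩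
      refine (hbound _ _).trans_lt (lt_of_le_of_lt ?_ hN)
      exact one_div_le_one_div_of_le (by positivity) (by simpa using hm)
    · rw [Function.extend_apply' _ _ _ hpy]
      simpa using hε

/-- Strong independence amounts to `n + 1` distinct members never factoring through `ℝⁿ`. -/
theorem stronglyIndep_of_forall_injective {X : Type*} [TopologicalSpace X] {𝒞 : Set C(X, ℝ)}
    (h : ∀ (n : ℕ) (φ : C(X, Fin n → ℝ)) (f : Fin (n + 1) → C(X, ℝ)), Function.Injective f →
      (∀ i, f i ∈ 𝒞) → ¬ ∀ i, ∃ g : C((Fin n → ℝ), ℝ), ∀ x, f i x = g (φ x)) :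
    StronglyIndep 𝒞 := by
  intro n φ
  rw [Cardinal.mk_le_iff_forall_finset_subset_card_le]
  intro T hT
  by_contra! hlt
  obtain ⟨j⟩ : Nonempty (Fin (n + 1) ↪ T) :=
    Function.Embedding.nonempty_of_card_le (by simpa using hlt)
  exact h n φ (fun i => (j i).1) (Subtype.val_injective.comp j.injective)
    (fun i => (hT (j i).2).1) fun i => (hT (j i).2).2

/-- A strongly independent family of size continuum forces every basic family to have size at
least continuum. -/
theorem StronglyIndep.continuum_le_basicCard {X : Type*} [TopologicalSpace X] {𝒞 : Set C(X, ℝ)}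
    (h : StronglyIndep 𝒞) (hc : 𝔠 ≤ #𝒞) : 𝔠 ≤ basicCard X := by
  refine le_csInf ⟨_, univ, fun f => ⟨1, fun _ => f, fun _ => .id ℝ, fun _ => mem_univ _,
    fun x => by simp⟩, rfl⟩ ?_
  rintro _ ⟨Φ, hΦ, rfl⟩
  have key : ∀ f : 𝒞, ∃ l : List Φ, ∃ g : C((Fin l.length → ℝ), ℝ),
      ∀ x, f.1 x = g fun i => (l.get i).1 x := by
    intro f
    obtain ⟨m, φ, g, hφ, hf⟩ := hΦ f
    refine ⟨List.ofFn fun i => ⟨φ i, hφ i⟩,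
      ⟨fun v => ∑ i, g i (v (Fin.cast (by simp) i)), by fun_prop⟩, fun x => ?_⟩
    simp [hf]
  choose l g hlg using key
  have hfib : ∀ L : List Φ, #(l ⁻¹' {L}) ≤ ℵ₀ := by
    intro L
    refine le_trans ?_ ((h L.length ⟨fun x i => (L.get i).1 x, by fun_prop⟩).trans
      Cardinal.natCast_lt_aleph0.le)
    refine Cardinal.mk_le_of_injective (f := fun f => ⟨f.1.1, f.1.2, ?_⟩) ?_
    · obtain ⟨f, rfl⟩ := f
      exact ⟨g f, hlg f⟩
    · intro a b hab
      exact Subtype.ext (Subtype.ext (Subtype.mk.inj hab))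
  have h1 := hc.trans (Cardinal.mk_le_mk_mul_of_mk_preimage_le l hfib)
  by_contra! hlt
  have h2 : #(List Φ) < 𝔠 :=
    (Cardinal.mk_list_le_max _).trans_lt (max_lt Cardinal.aleph0_lt_continuum hlt)
  exact absurd h1 (not_le.2 (Cardinal.mul_lt_of_lt Cardinal.aleph0_le_continuum h2
    Cardinal.aleph0_lt_continuum))

theorem stmt6 (C' : ℕ → Type) [∀ n, TopologicalSpace (C' n)]
    [∀ n, CompactSpace (C' n)] [∀ n, T2Space (C' n)]
    (hfd : ∀ n, ∃ m, DimLE (C' n) m) (hgt : ∀ n, ¬ DimLE (C' n) n)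
    (γ : Type) [TopologicalSpace γ] [CompactSpace γ] [T2Space γ]
    (ι : (Σ n, C' n) → γ) (hι : IsEmbedding ι) (hdense : DenseRange ι) :
    ∃ C : Set C(γ, ℝ),
      (∀ f ∈ C, ∀ y, f y ∈ Set.Icc (0:ℝ) 1) ∧ IsCantorSet C ∧
      StronglyIndep { f : C((Σ n, C' n), ℝ) | ∃ h ∈ C, ∀ x, f x = h (ι x) } ∧
      𝔠 ≤ basicCard (Σ n, C' n) ∧ 𝔠 ≤ basicCard γ := by
  choose K hKs hK using fun n => exists_isStableFamily (hgt n)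
  obtain ⟨e, he, hsep⟩ := exists_eventually_separating
  let q : (ℕ → Bool) → (Σ n, C' n) → ℝ := fun s p => K p.1 (e p.1 s) p.2 / ((p.1 : ℝ) + 1)
  have hq01 : ∀ s p, 0 ≤ q s p ∧ q s p ≤ 1 / ((p.1 : ℝ) + 1) := fun s p =>
    ⟨div_nonneg (hK _ _ _).1 (by positivity),
      div_le_div_of_nonneg_right (hK _ _ _).2 (by positivity)⟩
  have hcont : Continuous fun p : (ℕ → Bool) × γ => Function.extend ι (q p.1) 0 p.2 := by
    refine continuous_extend_sigma hι hdense q (fun m => ?_)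
      fun s p => abs_le.2 ⟨by linarith [hq01 s p], (hq01 s p).2⟩
    have h1 : Continuous fun p : Fin (m + 1) × C' m => K m p.1 p.2 :=
      continuous_prod_of_discrete_left.2 fun i => (K m i).continuous
    exact (h1.comp ((he m).prodMap continuous_id)).div_const ((m : ℝ) + 1)
  let h : C(ℕ → Bool, C(γ, ℝ)) := ContinuousMap.curry ⟨_, hcont⟩
  have hh : ∀ s p, h s (ι p) = q s p := fun s p =>
    hι.injective.extend_apply (q s) 0 p
  have hindep : ∀ (n : ℕ) (φ : C((Σ n, C' n), Fin n → ℝ)) (σ : Fin (n + 1) → ℕ → Bool),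
      Function.Injective σ →
      ¬ ∀ i, ∃ g : C((Fin n → ℝ), ℝ), ∀ x, h (σ i) (ι x) = g (φ x) := by
    intro n φ σ hσ hg
    choose g hg using hg
    have hev : ∀ᶠ m in Filter.atTop, ∀ i j, i ≠ j → e m (σ i) ≠ e m (σ j) := by
      simp only [Filter.eventually_all]
      exact fun i j hij => hsep _ _ (hσ.ne hij)
    obtain ⟨m, hm⟩ := hev.exists
    have hinj : Function.Injective fun i => e m (σ i) := fun i j hij => by
      by_contra hne
      exact hm i j hne hij
    have hst : IsStableFamily fun i => (⟨fun x => q (σ i) ⟨m, x⟩, by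
        exact (K m (e m (σ i))).continuous.div_const ((m : ℝ) + 1)⟩ : C(C' m, ℝ)) :=
      ((hKs m).comp_injective hinj).affine (a := ((m : ℝ) + 1)⁻¹) (b := 0) (by positivity)
        fun i y => by simp [q, div_eq_inv_mul]
    refine hst.not_factors (φ.comp ⟨Sigma.mk m, continuous_sigmaMk⟩) g fun i y => ?_
    exact (hh _ _).symm.trans (hg i _)
  have hinj : Function.Injective h := by
    intro s t hst
    by_contra hne
    refine hindep 1 ⟨fun x _ => h s (ι x), by have := hι.continuous; fun_prop⟩ ![s, t] ?_ ?_
    · intro i j hij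
      fin_cases i <;> fin_cases j <;> simp_all
    · intro i
      refine ⟨⟨fun v => v 0, by fun_prop⟩, fun x => ?_⟩
      fin_cases i <;> simp [hst]
  have hcard : 𝔠 ≤ #(range h) := by
    rw [Cardinal.mk_range_eq _ hinj]
    simp
  have hXindep : StronglyIndep { f : C((Σ n, C' n), ℝ) | ∃ k ∈ range h, ∀ x, f x = k (ι x) } := by
    refine stronglyIndep_of_forall_injective fun n φ f hf hfC hg => ?_
    have hfC' : ∀ i, ∃ s, ∀ x, f i x = h s (ι x) := fun i => by
      obtain ⟨_, ⟨s, rfl⟩, hs⟩ := hfC i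
      exact ⟨s, hs⟩
    choose σ hσ using hfC'
    refine hindep n φ σ (fun i j hij => hf (ContinuousMap.ext fun x => ?_)) fun i => ?_
    · rw [hσ, hσ, hij]
    · simpa only [← hσ] using hg i
  have hγindep : StronglyIndep (range h) := by
    refine stronglyIndep_of_forall_injective fun n φ f hf hfC hg => ?_
    choose σ hσ using hfC
    refine hindep n (φ.comp ⟨ι, hι.continuous⟩) σ
      (fun i j hij => hf (by rw [← hσ, ← hσ, hij])) fun i => ?_
    obtain ⟨g, hg⟩ := hg i
    exact ⟨g, fun x => by rw [hσ, hg]; rfl⟩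
  refine ⟨range h, ?_, ?_, hXindep, ?_, hγindep.continuum_le_basicCard hcard⟩
  · rintro _ ⟨s, rfl⟩ y
    by_cases hy : ∃ p, ι p = y
    · obtain ⟨p, rfl⟩ := hy
      rw [hh]
      refine ⟨(hq01 s p).1, (hq01 s p).2.trans ?_⟩
      exact (div_le_one (by positivity)).2 (by linarith [p.1.cast_nonneg (α := ℝ)])
    · have : h s y = 0 := Function.extend_apply' (q s) (0 : γ → ℝ) y hy
      simp [this]
  · exact ⟨(h.continuous.isClosedEmbedding hinj).isEmbedding.toHomeomorph.symm⟩
  · refine hXindep.continuum_le_basicCard ?_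
    let r : range h → { f : C((Σ n, C' n), ℝ) | ∃ k ∈ range h, ∀ x, f x = k (ι x) } :=
      fun k => ⟨k.1.comp ⟨ι, hι.continuous⟩, k.1, k.2, fun _ => rfl⟩
    refine hcard.trans (Cardinal.mk_le_of_injective (f := r) fun k k' hk => ?_)
    refine Subtype.ext (DFunLike.coe_injective
      (hdense.equalizer k.1.continuous k'.1.continuous (funext fun x => ?_)))
    exact DFunLike.congr_fun (Subtype.mk.inj hk) x


end
end
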